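/- arXiv:0812.0423 — 10 statements merged into one kernel-verified Lean document; each statement's English description precedes it below -/
import Mathlib

section
/- Let F be a set-valued mapping from ℝ^p to ℝ^q with closed graph, let ū ∈ ℝ^p and v̄ ∈ F(ū), and suppose F is metrically regular at ū for v̄: there exist constants κ > 0 and a > 0 such that for all u with ‖u − ū‖ ≤ a and all v with ‖v − v̄‖ ≤ a one has edist(u, F⁻¹(v)) ≤ κ · edist(v, F(u)). Then there exist constants δ > 0 and γ > 0 such that for every continuous linear map H : ℝ^p → ℝ^q with operator norm ‖H‖ < δ, every u with ‖u − ū‖ ≤ δ, and every v with ‖v − v̄‖ ≤ δ, one has edist(u, (F+H)⁻¹(v)) ≤ γ · edist(v, (F+H)(u)). -/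
open Filter

/-- Metric regularity lets one correct an approximate solution `u` of `y ∈ F u`, up to a factor
`2` in the regularity constant. -/
lemma exists_mem_dist_le_of_infEDist_le {E G : Type*} [PseudoMetricSpace E] [MetricSpace G]
    {F : E → Set G} {κ : ℝ} (hκ : 0 < κ) {u : E} {y w : G} (hw : w ∈ F u)
    (h : Metric.infEDist u {u' | y ∈ F u'} ≤ ENNReal.ofReal κ * Metric.infEDist y (F u)) :
    ∃ u', y ∈ F u' ∧ dist u u' ≤ 2 * κ * dist y w := by
  rcases eq_or_ne y w with rfl | hne
  · exact ⟨u, hw, by simp⟩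
  have hpos : 0 < dist y w := dist_pos.2 hne
  have hlt : Metric.infEDist u {u' | y ∈ F u'} < ENNReal.ofReal (2 * κ * dist y w) := by
    calc Metric.infEDist u {u' | y ∈ F u'}
        ≤ ENNReal.ofReal κ * edist y w :=
          h.trans (by gcongr; exact Metric.infEDist_le_edist_of_mem hw)
      _ = ENNReal.ofReal (κ * dist y w) := by
          rw [edist_dist, ENNReal.ofReal_mul hκ.le]
      _ < ENNReal.ofReal (2 * κ * dist y w) := by
          rw [ENNReal.ofReal_lt_ofReal_iff (by positivity)]
          nlinarith [mul_pos hκ hpos]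
  obtain ⟨u', hu', hd⟩ := Metric.infEDist_lt_iff.1 hlt
  refine ⟨u', hu', ?_⟩
  rw [edist_dist, ENNReal.ofReal_lt_ofReal_iff (by positivity)] at hd
  exact hd.le

/-- Lyusternik–Graves iteration: an approximate solution `u₀` of `v ∈ F u + H u` is corrected to an
exact one at a distance proportional to the residual. -/
lemma exists_sub_mem_dist_le_of_regular {E G : Type*} [NormedAddCommGroup E] [NormedSpace ℝ E]
    [CompleteSpace E] [NormedAddCommGroup G] [NormedSpace ℝ G] {F : E → Set G}
    (hF : IsClosed {x : E × G | x.2 ∈ F x.1}) {ubar : E} {vbar : G} {κ a : ℝ} (hκ : 0 < κ)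
    (hreg : ∀ u v, ‖u - ubar‖ ≤ a → ‖v - vbar‖ ≤ a →
      Metric.infEDist u {u' | v ∈ F u'} ≤ ENNReal.ofReal κ * Metric.infEDist v (F u))
    {H : E →L[ℝ] G} (hH : 4 * κ * ‖H‖ ≤ 1) {v : G}
    (hv : ∀ u, ‖u - ubar‖ ≤ a → ‖v - H u - vbar‖ ≤ a)
    {u₀ : E} {w₀ : G} (hw₀ : w₀ ∈ F u₀)
    (h₀ : ‖u₀ - ubar‖ + 4 * κ * dist (v - H u₀) w₀ ≤ a) :
    ∃ u, v - H u ∈ F u ∧ dist u₀ u ≤ 4 * κ * dist (v - H u₀) w₀ := by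
  set r := dist (v - H u₀) w₀ with hr
  have hr0 : 0 ≤ r := dist_nonneg
  have step : ∀ x : E × G, x.2 ∈ F x.1 → ‖x.1 - ubar‖ ≤ a →
      ∃ u', v - H x.1 ∈ F u' ∧ dist x.1 u' ≤ 2 * κ * dist (v - H x.1) x.2 := fun x hx hxa =>
    exists_mem_dist_le_of_infEDist_le hκ hx (hreg _ _ hxa (hv _ hxa))
  choose! f hfF hfd using step
  let s : ℕ → E × G := fun n => (fun x : E × G => (f x, v - H x.1))^[n] (u₀, w₀)
  have hs : ∀ n, s (n + 1) = (f (s n), v - H (s n).1) := fun n =>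
    Function.iterate_succ_apply' _ n _
  have ball : ∀ {u : E} {n : ℕ}, dist u₀ u ≤ 4 * κ * r * (1 - 1 / 2 ^ n) →
      ‖u - ubar‖ ≤ a := by
    intro u n h
    have h1 : ‖u - ubar‖ ≤ dist u₀ u + ‖u₀ - ubar‖ := by
      rw [← dist_eq_norm, ← dist_eq_norm, dist_comm u₀ u]
      exact dist_triangle _ _ _
    have h2 : 0 ≤ 4 * κ * r * (1 / 2 ^ n) := by positivity
    linarith
  have inv : ∀ n, (s n).2 ∈ F (s n).1 ∧ dist (v - H (s n).1) (s n).2 ≤ r / 2 ^ n ∧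
      dist u₀ (s n).1 ≤ 4 * κ * r * (1 - 1 / 2 ^ n) := by
    intro n
    induction n with
    | zero => exact ⟨hw₀, by simp [s, hr], by simp [s]⟩
    | succ n ih =>
      obtain ⟨hmem, hres, hdist⟩ := ih
      have hmove : dist (s n).1 (f (s n)) ≤ 2 * κ * (r / 2 ^ n) :=
        (hfd _ hmem (ball hdist)).trans (by gcongr)
      rw [hs]
      refine ⟨hfF _ hmem (ball hdist), ?_, ?_⟩
      · calc dist (v - H (f (s n))) (v - H (s n).1)
            = ‖H ((s n).1 - f (s n))‖ := by
              rw [dist_eq_norm, map_sub]; congr 1; abel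
          _ ≤ ‖H‖ * (2 * κ * (r / 2 ^ n)) := by
              rw [dist_eq_norm] at hmove
              exact H.le_opNorm_of_le hmove
          _ = 4 * κ * ‖H‖ * (r / 2 ^ (n + 1)) := by rw [pow_succ]; ring
          _ ≤ 1 * (r / 2 ^ (n + 1)) := by gcongr
          _ = r / 2 ^ (n + 1) := one_mul _
      · calc dist u₀ (f (s n)) ≤ dist u₀ (s n).1 + dist (s n).1 (f (s n)) := dist_triangle _ _ _
          _ ≤ 4 * κ * r * (1 - 1 / 2 ^ n) + 2 * κ * (r / 2 ^ n) := add_le_add hdist hmove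
          _ = 4 * κ * r * (1 - 1 / 2 ^ (n + 1)) := by rw [pow_succ]; field_simp; ring
  have hgeom : ∀ n, dist (s n).1 (s (n + 1)).1 ≤ 4 * κ * r / 2 / 2 ^ n := by
    intro n
    obtain ⟨hmem, hres, hdist⟩ := inv n
    rw [hs]
    calc dist (s n).1 (f (s n)) ≤ 2 * κ * (r / 2 ^ n) :=
          (hfd _ hmem (ball hdist)).trans (by gcongr)
      _ = 4 * κ * r / 2 / 2 ^ n := by ring
  obtain ⟨u, hu⟩ := cauchySeq_tendsto_of_complete (cauchySeq_of_le_geometric_two hgeom)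
  refine ⟨u, ?_, dist_le_of_le_geometric_two_of_tendsto₀ hgeom hu⟩
  have hlim : Tendsto (fun n => ((s (n + 1)).1, v - H (s n).1)) atTop (nhds (u, v - H u)) :=
    (hu.comp (tendsto_add_atTop_nat 1)).prodMk_nhds
      (tendsto_const_nhds.sub ((H.continuous.tendsto u).comp hu))
  refine hF.mem_of_tendsto hlim (Eventually.of_forall fun n => ?_)
  have := (inv (n + 1)).1
  rwa [hs] at this ⊢

/-- **Uniform metric regularity under perturbation.**
If a closed set-valued mapping `F : ℝ^p ⇉ ℝ^q` is metrically regular at `ū` for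
`v̄ ∈ F(ū)`, then for all sufficiently small linear perturbations `H`, the perturbed
mapping `F + H` is metrically regular near `(ū, v̄)` with a uniform constant. -/
theorem uniform_metric_regularity_under_perturbation (p q : ℕ)
    (F : EuclideanSpace ℝ (Fin p) → Set (EuclideanSpace ℝ (Fin q)))
    (hF : IsClosed {uw : EuclideanSpace ℝ (Fin p) × EuclideanSpace ℝ (Fin q) | uw.2 ∈ F uw.1})
    (ubar : EuclideanSpace ℝ (Fin p)) (vbar : EuclideanSpace ℝ (Fin q))
    (hvbar : vbar ∈ F ubar)
    (κ a : ℝ) (hκ : 0 < κ) (ha : 0 < a)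
    (hreg : ∀ u v, ‖u - ubar‖ ≤ a → ‖v - vbar‖ ≤ a →
      EMetric.infEdist u {u' | v ∈ F u'} ≤ ENNReal.ofReal κ * EMetric.infEdist v (F u)) :
    ∃ δ > (0:ℝ), ∃ γ > (0:ℝ),
      ∀ H : EuclideanSpace ℝ (Fin p) →L[ℝ] EuclideanSpace ℝ (Fin q), ‖H‖ < δ →
      ∀ u v, ‖u - ubar‖ ≤ δ → ‖v - vbar‖ ≤ δ →
        EMetric.infEdist u {u' | v - H u' ∈ F u'} ≤
          ENNReal.ofReal γ * EMetric.infEdist v ((fun w => w + H u) '' F u) := by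
  set M := 1 + ‖ubar‖ + a with hM
  have hMpos : 0 < M := by positivity
  obtain ⟨δ, hδ, hδa, hδκ, hδM, hδκM⟩ : ∃ δ > (0 : ℝ), δ ≤ a / 2 ∧ 4 * κ * δ ≤ 1 ∧
      δ * M ≤ a ∧ 4 * κ * (δ * M) ≤ a / 2 := by
    refine ⟨min (min (a / 2) (1 / (4 * κ))) (min (a / M) (a / (8 * κ * M))), by positivity,
      (min_le_left _ _).trans (min_le_left _ _), ?_, ?_, ?_⟩
    · rw [← le_div_iff₀' (by positivity)]
      exact (min_le_left _ _).trans (min_le_right _ _)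
    · rw [← le_div_iff₀ hMpos]
      exact (min_le_right _ _).trans (min_le_left _ _)
    · have h : min (min (a / 2) (1 / (4 * κ))) (min (a / M) (a / (8 * κ * M))) ≤
          a / (8 * κ * M) := (min_le_right _ _).trans (min_le_right _ _)
      rw [le_div_iff₀ (by positivity)] at h
      linarith
  refine ⟨δ, hδ, 8 * κ, by positivity, fun H hH u v hu hv => ?_⟩
  have hHκ : 4 * κ * ‖H‖ ≤ 1 := le_trans (by gcongr) hδκ
  have hshift : ∀ z, ‖z - ubar‖ ≤ a → ‖v - H z - vbar‖ ≤ δ * M := by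
    intro z hz
    have hzn : ‖z‖ ≤ ‖ubar‖ + a := by
      linarith [norm_sub_norm_le z ubar]
    have hHz : ‖H z‖ ≤ δ * (‖ubar‖ + a) := H.le_of_opNorm_le_of_le hH.le hzn
    calc ‖v - H z - vbar‖ = ‖(v - vbar) - H z‖ := by congr 1; abel
      _ ≤ ‖v - vbar‖ + ‖H z‖ := norm_sub_le _ _
      _ ≤ δ * M := by rw [hM]; linarith
  have hball : ∀ z, ‖z - ubar‖ ≤ a → ‖v - H z - vbar‖ ≤ a := fun z hz => (hshift z hz).trans hδM
  have hsolve : ∀ w ∈ F u, ∃ u', v - H u' ∈ F u' ∧ dist u u' ≤ 8 * κ * dist (v - H u) w := by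
    intro w hw
    have hnonneg : 0 ≤ κ * dist (v - H u) w := by positivity
    by_cases hsmall : ‖u - ubar‖ + 4 * κ * dist (v - H u) w ≤ a
    · obtain ⟨u', hu', hd⟩ := exists_sub_mem_dist_le_of_regular hF hκ hreg hHκ hball hw hsmall
      exact ⟨u', hu', by linarith⟩
    · have hres : 4 * κ * dist (v - H ubar) vbar ≤ a / 2 := by
        refine le_trans ?_ hδκM
        rw [dist_eq_norm]
        gcongr
        exact hshift ubar (by simpa using ha.le)
      obtain ⟨u', hu', hd⟩ := exists_sub_mem_dist_le_of_regular hF hκ hreg hHκ hball hvbar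
        (by rw [sub_self, norm_zero]; linarith)
      refine ⟨u', hu', ?_⟩
      have htri := dist_triangle u ubar u'
      rw [dist_eq_norm u ubar] at htri
      linarith
  have hγ : ENNReal.ofReal (8 * κ) ≠ 0 := by simpa using hκ
  rw [mul_comm, ← ENNReal.div_le_iff_le_mul (Or.inl hγ) (Or.inl ENNReal.ofReal_ne_top)]
  refine Metric.le_infEDist.2 ?_
  rintro _ ⟨w, hw, rfl⟩
  obtain ⟨u', hu', hd⟩ := hsolve w hw
  rw [ENNReal.div_le_iff_le_mul (Or.inl hγ) (Or.inl ENNReal.ofReal_ne_top), mul_comm]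
  calc Metric.infEDist u {u' | v - H u' ∈ F u'} ≤ edist u u' :=
        Metric.infEDist_le_edist_of_mem hu'
    _ ≤ ENNReal.ofReal (8 * κ * dist (v - H u) w) := by
        rw [edist_dist]; exact ENNReal.ofReal_le_ofReal hd
    _ = ENNReal.ofReal (8 * κ) * edist v (w + H u) := by
        rw [ENNReal.ofReal_mul (by positivity), edist_dist, dist_eq_norm, dist_eq_norm,
          sub_sub, add_comm w]
end

section
/- Let τ > 1 and ρ > 0 be real constants and t ≥ 1 a positive integer. Then for every vector α ∈ ℝ^t with α_i ≥ 0 for all i and Σ_{i=1}^t α_i ≥ ρ, one has Σ_{i=1}^t α_i² τ^i > ρ² (τ − 1). -/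
theorem sub_one_mul_sum_inv_pow_succ {K : Type*} [Field K] {x : K} (hx : x ≠ 0) (n : ℕ) :
    (x - 1) * ∑ i : Fin n, (x ^ ((i : ℕ) + 1))⁻¹ = 1 - (x ^ n)⁻¹ := by
  induction n with
  | zero => simp
  | succ n ih =>
    rw [Fin.sum_univ_castSucc, mul_add]
    simp only [Fin.val_castSucc, Fin.val_last, ih]
    field_simp
    ring

/-- For constants `τ > 1`, `ρ > 0` and a positive integer `t`, every nonnegative vector
`α ∈ ℝ^t` with `∑ αᵢ ≥ ρ` satisfies `∑ αᵢ² τ^i > ρ² (τ - 1)`, where the power `i`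
runs from `1` to `t`. -/
theorem sum_sq_weighted_pow_gt (τ ρ : ℝ) (hτ : 1 < τ) (hρ : 0 < ρ)
    (t : ℕ) (ht : 1 ≤ t) (α : Fin t → ℝ)
    (hα : ∀ i, 0 ≤ α i) (hsum : ρ ≤ ∑ i, α i) :
    ρ ^ 2 * (τ - 1) < ∑ i : Fin t, (α i) ^ 2 * τ ^ ((i : ℕ) + 1) := by
  have hτ0 : 0 < τ := by linarith
  have hgeom := sub_one_mul_sum_inv_pow_succ hτ0.ne' t
  have hcs : (∑ i, α i) ^ 2 ≤
      (∑ i : Fin t, (α i) ^ 2 * τ ^ ((i : ℕ) + 1)) * ∑ i : Fin t, (τ ^ ((i : ℕ) + 1))⁻¹ :=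
    Finset.sum_sq_le_sum_mul_sum_of_sq_le_mul _ (fun i _ => by positivity)
      (fun i _ => by positivity) (fun i _ => Eq.le (by field_simp))
  have hG : 0 ≤ ∑ i : Fin t, (τ ^ ((i : ℕ) + 1))⁻¹ :=
    Finset.sum_nonneg fun i _ => by positivity
  set S := ∑ i : Fin t, (α i) ^ 2 * τ ^ ((i : ℕ) + 1)
  set G := ∑ i : Fin t, (τ ^ ((i : ℕ) + 1))⁻¹
  have hSG : ρ ^ 2 ≤ S * G := (pow_le_pow_left₀ hρ.le hsum 2).trans hcs
  have hS : 0 < S := pos_of_mul_pos_left ((pow_pos hρ 2).trans_le hSG) hG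
  have hpow : 0 < (τ ^ t)⁻¹ := by positivity
  calc ρ ^ 2 * (τ - 1) ≤ S * G * (τ - 1) := mul_le_mul_of_nonneg_right hSG (by linarith)
    _ = S * (1 - (τ ^ t)⁻¹) := by rw [← hgeom]; ring
    _ < S := mul_lt_of_lt_one_right hS (by linarith)
end

section
/- Let c : ℝⁿ → ℝᵐ be twice continuously differentiable on a neighborhood of a point x̄ ∈ ℝⁿ, let h : ℝᵐ → ℝ be convex, and suppose the criticality condition holds: there exists v̄ ∈ ∂h(c(x̄)) with Dc(x̄)* v̄ = 0. Then there exist constants μ̄ ≥ 0, δ > 0 and ρ ≥ 0 such that: (a) for every x with ‖x − x̄‖ ≤ δ and every μ > μ̄, the function d ↦ h(c(x) + Dc(x) d) + (μ/2)‖d‖² has a unique global minimizer d(x,μ), and ‖d(x,μ)‖ ≤ ρ‖x − x̄‖; and (b) for any sequences x_r → x̄ and μ_r > μ̄ with μ_r‖x_r − x̄‖² → 0, one has h(c(x_r) + Dc(x_r) d(x_r,μ_r)) → h(c(x̄)). -/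
open Filter Topology RealInnerProductSpace

/-- `v` is a subgradient of `h` at `c₀`: `h(c') ≥ h(c₀) + ⟪v, c' - c₀⟫` for all `c'`. -/
def IsSubgradient {m : ℕ} (h : EuclideanSpace ℝ (Fin m) → ℝ)
    (c₀ v : EuclideanSpace ℝ (Fin m)) : Prop :=
  ∀ c', h c₀ + ⟪v, c' - c₀⟫ ≤ h c'

/-- Existence and uniqueness of the proximal point of a convex function minorized by a cone. -/
theorem ConvexOn.existsUnique_forall_add_sq_norm_le {E : Type*} [NormedAddCommGroup E]
    [InnerProductSpace ℝ E] [FiniteDimensional ℝ E] {f : E → ℝ} (hf : ConvexOn ℝ Set.univ f)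
    {α β : ℝ} (hlow : ∀ d, α - β * ‖d‖ ≤ f d) {μ : ℝ} (hμ : 0 < μ) :
    ∃! d, ∀ d', f d + μ / 2 * ‖d‖ ^ 2 ≤ f d' + μ / 2 * ‖d'‖ ^ 2 := by
  have hcont : Continuous f := hf.locallyLipschitz.continuous
  have hstrict : StrictConvexOn ℝ Set.univ fun d => f d + μ / 2 * ‖d‖ ^ 2 := by
    have hstrong : StrongConvexOn Set.univ μ fun d => f d + μ / 2 * ‖d‖ ^ 2 := by
      rw [strongConvexOn_iff_convex]
      simpa using hf
    exact hstrong.strictConvexOn hμ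
  have hquad : Tendsto (fun t : ℝ => α + t * (μ / 2 * t - β)) atTop atTop := by
    refine tendsto_atTop_add_const_left _ _ (tendsto_id.atTop_mul_atTop₀ ?_)
    exact tendsto_atTop_add_const_right _ _ (tendsto_id.const_mul_atTop (by positivity))
  have hcoer : Tendsto (fun d => f d + μ / 2 * ‖d‖ ^ 2) (cocompact E) atTop := by
    refine tendsto_atTop_mono (fun d => ?_) (hquad.comp (tendsto_norm_cocompact_atTop (E := E)))
    simp only [Function.comp_apply]
    linarith [hlow d]
  obtain ⟨d, hd⟩ := Continuous.exists_forall_le (by fun_prop) hcoer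
  refine ⟨d, hd, fun d₀ hd₀ => ?_⟩
  exact hstrict.eq_of_isMinOn (fun y _ => hd₀ y) (fun y _ => hd y) trivial trivial

/-- Near a point where `c` is `C²`, the derivative is Lipschitz relative to that point and
the first-order Taylor remainder is quadratic. -/
theorem ContDiffAt.exists_eventually_taylor_le {E F : Type*} [NormedAddCommGroup E]
    [NormedSpace ℝ E] [NormedAddCommGroup F] [NormedSpace ℝ F] {c : E → F} {x₀ : E}
    (hc : ContDiffAt ℝ 2 c x₀) :
    ∃ K ≥ (0 : ℝ), ∀ᶠ x in 𝓝 x₀, ‖fderiv ℝ c x - fderiv ℝ c x₀‖ ≤ K * ‖x - x₀‖ ∧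
      ‖c x - c x₀ - fderiv ℝ c x₀ (x - x₀)‖ ≤ K * ‖x - x₀‖ ^ 2 := by
  obtain ⟨K, t, ht, hK⟩ :=
    (hc.fderiv_right (m := 1) (by norm_num)).exists_lipschitzOnWith
  have hdiff : ∀ᶠ y in 𝓝 x₀, DifferentiableAt ℝ c y :=
    (hc.eventually (by simp)).mono fun y hy => hy.differentiableAt (by simp)
  obtain ⟨ε, hε, hball⟩ := Metric.eventually_nhds_iff_ball.1 (hdiff.and ht)
  have hlip : ∀ y ∈ Metric.ball x₀ ε, ‖fderiv ℝ c y - fderiv ℝ c x₀‖ ≤ K * ‖y - x₀‖ :=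
    fun y hy => hK.norm_sub_le (hball y hy).2 (mem_of_mem_nhds ht)
  refine ⟨K, K.2, Metric.eventually_nhds_iff_ball.2 ⟨ε, hε, fun x hx => ⟨hlip x hx, ?_⟩⟩⟩
  have hsub : Metric.closedBall x₀ ‖x - x₀‖ ⊆ Metric.ball x₀ ε :=
    Metric.closedBall_subset_ball (mem_ball_iff_norm.1 hx)
  have htaylor := (convex_closedBall x₀ ‖x - x₀‖).norm_image_sub_le_of_norm_fderiv_le' (𝕜 := ℝ)
    (f := c) (φ := fderiv ℝ c x₀) (C := K * ‖x - x₀‖) (x := x₀) (y := x)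
    (fun y hy => (hball y (hsub hy)).1)
    (fun y hy => (hlip y (hsub hy)).trans
      (mul_le_mul_of_nonneg_left (mem_closedBall_iff_norm.1 hy) K.2))
    (Metric.mem_closedBall_self (norm_nonneg _)) (mem_closedBall_iff_norm.2 le_rfl)
  rwa [mul_assoc, ← sq] at htaylor

/-- Evaluation of continuous linear maps is jointly continuous, in terms of limits. -/
theorem Filter.Tendsto.continuousLinearMap_apply {X E F : Type*} [NormedAddCommGroup E]
    [NormedSpace ℝ E] [NormedAddCommGroup F] [NormedSpace ℝ F] {l : Filter X}
    {f : X → E →L[ℝ] F} {g : X → E} {A : E →L[ℝ] F} {d : E}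
    (hf : Tendsto f l (𝓝 A)) (hg : Tendsto g l (𝓝 d)) :
    Tendsto (fun x => f x (g x)) l (𝓝 (A d)) :=
  (isBoundedBilinearMap_apply.continuous.tendsto (A, d)).comp (hf.prodMk_nhds hg)

/-- A quadratic inequality bounding the length `s` of a proximal step by the distance `e`. -/
theorem le_mul_of_half_mul_sq_le {A B e s μ : ℝ} (hA : 0 ≤ A) (hB : 0 ≤ B) (he : 0 ≤ e)
    (hμ : 1 ≤ μ) (h : μ / 2 * s ^ 2 ≤ μ / 2 * e ^ 2 + A * e ^ 2 + B * e * s) :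
    s ≤ (1 + 2 * A + 2 * B) * e := by
  by_contra! hlt
  have hes : e ≤ s := by nlinarith [mul_nonneg hA he, mul_nonneg hB he]
  have hgap : s ^ 2 - e ^ 2 ≤ μ * (s ^ 2 - e ^ 2) :=
    le_mul_of_one_le_left (by nlinarith) hμ
  have hpos : 0 < s := lt_of_le_of_lt (by positivity) hlt
  nlinarith [mul_lt_mul_of_pos_right hlt hpos, mul_le_mul_of_nonneg_left hes he,
    mul_le_mul_of_nonneg_left (mul_le_mul_of_nonneg_left hes he) hA]

/-- **Proximal step theorem (convex case).**  If `c` is `C²` near a critical point `x̄`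
of the composite `h ∘ c` with `h` convex, then there are `μ̄ ≥ 0`, `δ > 0`, `ρ ≥ 0` and a
step mapping `d(x, μ)` such that: (a) for `‖x - x̄‖ ≤ δ` and `μ > μ̄`, `d(x,μ)` is the
unique global minimizer of the proximal linearized subproblem
`d ↦ h(c(x) + Dc(x) d) + (μ/2)‖d‖²` and `‖d(x,μ)‖ ≤ ρ‖x - x̄‖`;
(b) along sequences `x_r → x̄`, `μ_r > μ̄` with `μ_r ‖x_r - x̄‖² → 0`, the linearized
values `h(c(x_r) + Dc(x_r) d(x_r, μ_r))` converge to the critical value `h(c(x̄))`. -/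
theorem proximal_step_convex (n m : ℕ)
    (c : EuclideanSpace ℝ (Fin n) → EuclideanSpace ℝ (Fin m))
    (h : EuclideanSpace ℝ (Fin m) → ℝ)
    (xbar : EuclideanSpace ℝ (Fin n))
    (hc : ContDiffAt ℝ 2 c xbar)
    (hconv : ConvexOn ℝ Set.univ h)
    (hcrit : ∃ vbar, IsSubgradient h (c xbar) vbar ∧
      ContinuousLinearMap.adjoint (fderiv ℝ c xbar) vbar = 0) :
    ∃ μbar ≥ (0:ℝ), ∃ δ > (0:ℝ), ∃ ρ ≥ (0:ℝ),
      ∃ dmap : EuclideanSpace ℝ (Fin n) → ℝ → EuclideanSpace ℝ (Fin n),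
      (∀ x μ, ‖x - xbar‖ ≤ δ → μbar < μ →
        (∀ d', h (c x + fderiv ℝ c x (dmap x μ)) + μ / 2 * ‖dmap x μ‖ ^ 2 ≤
            h (c x + fderiv ℝ c x d') + μ / 2 * ‖d'‖ ^ 2) ∧
        (∀ d₀, (∀ d', h (c x + fderiv ℝ c x d₀) + μ / 2 * ‖d₀‖ ^ 2 ≤
            h (c x + fderiv ℝ c x d') + μ / 2 * ‖d'‖ ^ 2) → d₀ = dmap x μ) ∧
        ‖dmap x μ‖ ≤ ρ * ‖x - xbar‖) ∧
      (∀ (xr : ℕ → EuclideanSpace ℝ (Fin n)) (μr : ℕ → ℝ),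
        Tendsto xr atTop (𝓝 xbar) → (∀ r, μbar < μr r) →
        Tendsto (fun r => μr r * ‖xr r - xbar‖ ^ 2) atTop (𝓝 0) →
        Tendsto (fun r => h (c (xr r) + fderiv ℝ c (xr r) (dmap (xr r) (μr r))))
          atTop (𝓝 (h (c xbar)))) := by
  obtain ⟨v, hv, hvadj⟩ := hcrit
  have hvD : ∀ d, ⟪v, fderiv ℝ c xbar d⟫ = 0 := fun d => by
    rw [← ContinuousLinearMap.adjoint_inner_left, hvadj, inner_zero_left]
  have hcont : Continuous h := hconv.locallyLipschitz.continuous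
  have hccont : Tendsto c (𝓝 xbar) (𝓝 (c xbar)) := hc.continuousAt
  have hDcont : Tendsto (fderiv ℝ c) (𝓝 xbar) (𝓝 (fderiv ℝ c xbar)) :=
    (hc.fderiv_right (m := 1) (by norm_num)).continuousAt
  obtain ⟨K, hK, hTaylor⟩ := hc.exists_eventually_taylor_le
  obtain ⟨L, t, ht, hL⟩ := hconv.locallyLipschitz (c xbar)
  have hback : Tendsto (fun x => c x + fderiv ℝ c x (xbar - x)) (𝓝 xbar) (𝓝 (c xbar)) := by
    have hstep : Tendsto (fun x => xbar - x) (𝓝 xbar) (𝓝 0) := by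
      simpa using (tendsto_const_nhds (x := xbar)).sub (tendsto_id (x := 𝓝 xbar))
    simpa using hccont.add (hDcont.continuousLinearMap_apply hstep)
  obtain ⟨δ, hδ, hnear⟩ :=
    Metric.nhds_basis_closedBall.eventually_iff.1 (hTaylor.and (hback ht))
  -- Lower bound for the linearized values, from the subgradient at the critical point.
  have hlow : ∀ x d, ‖x - xbar‖ ≤ δ → h (c xbar) - ‖v‖ * K * ‖x - xbar‖ ^ 2 -
      ‖v‖ * K * ‖x - xbar‖ * ‖d‖ ≤ h (c x + fderiv ℝ c x d) := by
    intro x d hx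
    obtain ⟨⟨hD, hR⟩, -⟩ := hnear (mem_closedBall_iff_norm.2 hx)
    have hsplit : ⟪v, c x + fderiv ℝ c x d - c xbar⟫ =
        ⟪v, c x - c xbar - fderiv ℝ c xbar (x - xbar)⟫ +
          ⟪v, (fderiv ℝ c x - fderiv ℝ c xbar) d⟫ := by
      simp only [inner_sub_right, inner_add_right, sub_apply, hvD]
      ring
    have hrem : ‖⟪v, c x - c xbar - fderiv ℝ c xbar (x - xbar)⟫‖ ≤
        ‖v‖ * (K * ‖x - xbar‖ ^ 2) :=
      (norm_inner_le_norm _ _).trans (by gcongr)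
    have hlin : ‖⟪v, (fderiv ℝ c x - fderiv ℝ c xbar) d⟫‖ ≤
        ‖v‖ * (K * ‖x - xbar‖ * ‖d‖) :=
      (norm_inner_le_norm _ _).trans (by
        gcongr
        exact ContinuousLinearMap.le_of_opNorm_le _ hD d)
    have hsub := hv (c x + fderiv ℝ c x d)
    rw [hsplit] at hsub
    rw [Real.norm_eq_abs] at hrem hlin
    linarith [neg_le_of_abs_le hrem, neg_le_of_abs_le hlin]
  -- Upper bound for the linearized value at the step leading back to `xbar`.
  have hup : ∀ x, ‖x - xbar‖ ≤ δ →
      h (c x + fderiv ℝ c x (xbar - x)) ≤ h (c xbar) + 2 * L * K * ‖x - xbar‖ ^ 2 := by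
    intro x hx
    obtain ⟨⟨hD, hR⟩, hmem⟩ := hnear (mem_closedBall_iff_norm.2 hx)
    have hdist : ‖c x + fderiv ℝ c x (xbar - x) - c xbar‖ ≤ 2 * K * ‖x - xbar‖ ^ 2 := by
      have hsplit : c x + fderiv ℝ c x (xbar - x) - c xbar =
          (c x - c xbar - fderiv ℝ c xbar (x - xbar)) -
            (fderiv ℝ c x - fderiv ℝ c xbar) (x - xbar) := by
        simp only [map_sub, sub_apply]
        abel
      rw [hsplit]
      refine (norm_sub_le _ _).trans ?_
      linarith [ContinuousLinearMap.le_of_opNorm_le _ hD (x - xbar)]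
    have hLip := hL.norm_sub_le hmem (mem_of_mem_nhds ht)
    beta_reduce at hLip
    rw [Real.norm_eq_abs] at hLip
    linarith [le_of_abs_le hLip, mul_le_mul_of_nonneg_left hdist L.coe_nonneg]
  have hexists : ∀ x μ, ‖x - xbar‖ ≤ δ → 1 < μ →
      ∃! d, ∀ d', h (c x + fderiv ℝ c x d) + μ / 2 * ‖d‖ ^ 2 ≤
        h (c x + fderiv ℝ c x d') + μ / 2 * ‖d'‖ ^ 2 := by
    intro x μ hx hμ
    have hconvx : ConvexOn ℝ Set.univ fun d => h (c x + fderiv ℝ c x d) :=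
      (hconv.translate_right (c x)).comp_linearMap (fderiv ℝ c x).toLinearMap
    exact hconvx.existsUnique_forall_add_sq_norm_le (fun d => hlow x d hx) (by linarith)
  choose! dmap hmin huniq using hexists
  let ρ : ℝ := 1 + 2 * (2 * L * K + ‖v‖ * K) + 2 * (‖v‖ * K)
  have hbound : ∀ x μ, ‖x - xbar‖ ≤ δ → 1 < μ → ‖dmap x μ‖ ≤ ρ * ‖x - xbar‖ := by
    intro x μ hx hμ
    refine le_mul_of_half_mul_sq_le (by positivity) (by positivity) (norm_nonneg _) hμ.le ?_
    have hcmp := hmin x μ hx hμ (xbar - x)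
    rw [norm_sub_rev xbar x] at hcmp
    linarith [hlow x (dmap x μ) hx, hup x hx]
  refine ⟨1, zero_le_one, δ, hδ, ρ, by positivity, dmap,
    fun x μ hx hμ => ⟨hmin x μ hx hμ, huniq x μ hx hμ, hbound x μ hx hμ⟩, ?_⟩
  intro xr μr hxr hμr _
  have hnorm : Tendsto (fun r => ρ * ‖xr r - xbar‖) atTop (𝓝 0) := by
    simpa using (tendsto_iff_norm_sub_tendsto_zero.1 hxr).const_mul ρ
  have hclose : ∀ᶠ r in atTop, ‖xr r - xbar‖ ≤ δ :=
    (hxr.eventually (Metric.closedBall_mem_nhds xbar hδ)).mono fun r hr =>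
      mem_closedBall_iff_norm.1 hr
  have hd : Tendsto (fun r => dmap (xr r) (μr r)) atTop (𝓝 0) :=
    squeeze_zero_norm' (hclose.mono fun r hr => hbound _ _ hr (hμr r)) hnorm
  have hlim := (hccont.comp hxr).add ((hDcont.comp hxr).continuousLinearMap_apply hd)
  rw [map_zero, add_zero] at hlim
  exact (hcont.tendsto _).comp hlim
end

section
/- Let σ ∈ (0,1), let c : ℝⁿ → ℝᵐ be twice continuously differentiable on a neighborhood of x̄ ∈ ℝⁿ, and let h : ℝᵐ → ℝ be Lipschitz continuous on a neighborhood of c(x̄). Then there exist constants μ̃ > 0 and δ̃ > 0 with the following property: for every x with ‖x − x̄‖ ≤ δ̃, every d ∈ ℝⁿ with ‖d‖ ≤ δ̃, and every μ ≥ μ̃ such that h(c(x) + Dc(x) d) + (μ/2)‖d‖² ≤ h(c(x)), one has h(c(x)) − h(c(x + d)) ≥ σ [ h(c(x)) − h(c(x) + Dc(x) d) ]. -/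
open Topology

/-- Second-order Taylor bound for a `C²` function, uniform in the base point: the remainder of
the linearization at `y` in direction `d` is `O(‖d‖²)` for `(y, d)` near `(x, 0)`. -/
theorem ContDiffAt.exists_eventually_norm_sub_sub_fderiv_le {E F : Type*}
    [NormedAddCommGroup E] [NormedSpace ℝ E] [NormedAddCommGroup F] [NormedSpace ℝ F]
    {f : E → F} {x : E} (hf : ContDiffAt ℝ 2 f x) :
    ∃ L : NNReal, ∀ᶠ p : E × E in 𝓝 (x, 0),
      ‖f (p.1 + p.2) - f p.1 - fderiv ℝ f p.1 p.2‖ ≤ L * ‖p.2‖ ^ 2 := by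
  have hf' : ContDiffAt ℝ 1 (fderiv ℝ f) x := hf.fderiv_right (by norm_num)
  obtain ⟨L, t, ht, hL⟩ := hf'.exists_lipschitzOnWith
  have hdiff : ∀ᶠ y in 𝓝 x, DifferentiableAt ℝ f y :=
    (hf.eventually (by simp)).mono fun y hy => hy.differentiableAt (by simp)
  obtain ⟨ε, hε, hball⟩ := Metric.eventually_nhds_iff_ball.mp (hdiff.and ht)
  have hfst : ∀ᶠ p : E × E in 𝓝 (x, 0), p.1 ∈ Metric.ball x ε :=
    continuous_fst.continuousAt.eventually (Metric.ball_mem_nhds x hε)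
  have hadd : ∀ᶠ p : E × E in 𝓝 (x, 0), p.1 + p.2 ∈ Metric.ball x ε :=
    ((continuous_fst.add continuous_snd).tendsto' (x, 0) x (add_zero x)).eventually
      (Metric.ball_mem_nhds x hε)
  refine ⟨L, ?_⟩
  filter_upwards [hfst, hadd] with ⟨y, d⟩ hy hyd
  have hseg : segment ℝ y (y + d) ⊆ Metric.ball x ε :=
    (convex_ball x ε).segment_subset hy hyd
  have bound : ∀ z ∈ segment ℝ y (y + d), ‖fderiv ℝ f z - fderiv ℝ f y‖ ≤ L * ‖d‖ := by
    intro z hz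
    refine (hL.norm_sub_le (hball z (hseg hz)).2 (hball y hy).2).trans ?_
    gcongr
    simpa using norm_sub_le_of_mem_segment hz
  have key := (convex_segment y (y + d)).norm_image_sub_le_of_norm_fderiv_le'
    (fun z hz => (hball z (hseg hz)).1) bound (left_mem_segment ℝ y (y + d))
    (right_mem_segment ℝ y (y + d))
  simpa [pow_two, mul_assoc] using key

/-- **Step acceptance (Lipschitz case).** Let `σ ∈ (0,1)`, `c` be `C²` near `x̄`, and `h`
be Lipschitz near `c(x̄)`.  Then there are `μ̃ > 0` and `δ̃ > 0` such that whenever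
`‖x - x̄‖ ≤ δ̃`, `‖d‖ ≤ δ̃`, `μ ≥ μ̃` and the step `d` does not increase the proximal
linearized objective, i.e. `h(c(x) + Dc(x)d) + (μ/2)‖d‖² ≤ h(c(x))`, the sufficient
decrease condition `h(c(x)) - h(c(x+d)) ≥ σ [h(c(x)) - h(c(x) + Dc(x) d)]` holds. -/
theorem proxdescent_sufficient_decrease (n m : ℕ) (σ : ℝ) (hσ : σ ∈ Set.Ioo (0:ℝ) 1)
    (c : EuclideanSpace ℝ (Fin n) → EuclideanSpace ℝ (Fin m))
    (h : EuclideanSpace ℝ (Fin m) → ℝ)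
    (xbar : EuclideanSpace ℝ (Fin n))
    (hc : ContDiffAt ℝ 2 c xbar)
    (hlip : ∃ (K : NNReal) (s : Set (EuclideanSpace ℝ (Fin m))),
      s ∈ 𝓝 (c xbar) ∧ LipschitzOnWith K h s) :
    ∃ μtil > (0:ℝ), ∃ δtil > (0:ℝ), ∀ (x d : EuclideanSpace ℝ (Fin n)) (μ : ℝ),
      ‖x - xbar‖ ≤ δtil → ‖d‖ ≤ δtil → μtil ≤ μ →
      h (c x + fderiv ℝ c x d) + μ / 2 * ‖d‖ ^ 2 ≤ h (c x) →
      σ * (h (c x) - h (c x + fderiv ℝ c x d)) ≤ h (c x) - h (c (x + d)) := by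
  obtain ⟨hσ0, hσ1⟩ := hσ
  obtain ⟨K, s, hs, hK⟩ := hlip
  obtain ⟨L, hL⟩ := hc.exists_eventually_norm_sub_sub_fderiv_le
  have hcont : ContinuousAt c xbar := hc.continuousAt
  have hcont' : ContinuousAt (fderiv ℝ c) xbar :=
    (hc.fderiv_right (m := 1) (by norm_num)).continuousAt
  have hnew : ∀ᶠ p : EuclideanSpace ℝ (Fin n) × EuclideanSpace ℝ (Fin n) in 𝓝 (xbar, 0),
      c (p.1 + p.2) ∈ s :=
    (hcont.tendsto.comp ((continuous_fst.add continuous_snd).tendsto' (xbar, 0) xbar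
      (add_zero xbar))).eventually hs
  have hlin : ∀ᶠ p : EuclideanSpace ℝ (Fin n) × EuclideanSpace ℝ (Fin n) in 𝓝 (xbar, 0),
      c p.1 + fderiv ℝ c p.1 p.2 ∈ s := by
    have hsum : ContinuousAt (fun p : EuclideanSpace ℝ (Fin n) × EuclideanSpace ℝ (Fin n) =>
        c p.1 + fderiv ℝ c p.1 p.2) (xbar, 0) :=
      hcont.fst'.add (hcont'.fst'.clm_apply continuousAt_snd)
    exact hsum.eventually_mem (by simpa using hs)
  obtain ⟨ε, hε, hball⟩ := Metric.eventually_nhds_iff_ball.mp (hL.and (hnew.and hlin))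
  have hKL : (0 : ℝ) ≤ K * L := by positivity
  have hσ' : 0 < 1 - σ := sub_pos.mpr hσ1
  refine ⟨2 * (K * L + 1) / (1 - σ), by positivity, ε / 2, by positivity, ?_⟩
  intro x d μ hx hd hμ hdec
  have hmem : (x, d) ∈ Metric.ball
      ((xbar, 0) : EuclideanSpace ℝ (Fin n) × EuclideanSpace ℝ (Fin n)) ε := by
    rw [Metric.mem_ball, Prod.dist_eq, max_lt_iff, dist_eq_norm, dist_eq_norm, sub_zero]
    exact ⟨by linarith, by linarith⟩
  obtain ⟨hrem, hnew_mem, hlin_mem⟩ := hball _ hmem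
  dsimp only at hrem hnew_mem hlin_mem
  have hh : h (c (x + d)) - h (c x + fderiv ℝ c x d) ≤ K * L * ‖d‖ ^ 2 :=
    calc h (c (x + d)) - h (c x + fderiv ℝ c x d)
        ≤ ‖h (c (x + d)) - h (c x + fderiv ℝ c x d)‖ := le_abs_self _
      _ ≤ K * ‖c (x + d) - (c x + fderiv ℝ c x d)‖ := hK.norm_sub_le hnew_mem hlin_mem
      _ ≤ K * (L * ‖d‖ ^ 2) := by
        rw [← sub_sub]
        gcongr
      _ = K * L * ‖d‖ ^ 2 := by ring
  have hμ' : K * L ≤ (1 - σ) * (μ / 2) := by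
    rw [div_le_iff₀ hσ'] at hμ
    linarith
  have hprod : K * L * ‖d‖ ^ 2 ≤ (1 - σ) * (μ / 2 * ‖d‖ ^ 2) := by
    rw [← mul_assoc]
    gcongr
  have hgain : (1 - σ) * (μ / 2 * ‖d‖ ^ 2)
      ≤ (1 - σ) * (h (c x) - h (c x + fderiv ℝ c x d)) :=
    mul_le_mul_of_nonneg_left (by linarith) hσ'.le
  linarith
end

section
/- Define h : ℝ → ℝ by h(c) = −c for c ≤ 0 and h(c) = 1 + c for c > 0. Let μ > 0 and let x be a real number with x > 1/μ + √(2/μ). Then d* = −1/μ is the unique global minimizer over d ∈ ℝ of the function φ(d) = h(x + d) + (μ/2) d², the minimum value is φ(d*) = 1 + x − 1/(2μ), and h(x + d*) = 1 + x − 1/μ > 1. -/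
/-- For the scalar outer function `h(c) = -c` for `c ≤ 0` and `h(c) = 1 + c` for `c > 0`,
`μ > 0` and `x > 1/μ + √(2/μ)`, the point `d* = -1/μ` is the unique global minimizer of
`φ(d) = h(x + d) + (μ/2) d²`, with minimum value `φ(d*) = 1 + x - 1/(2μ)`, and the
corresponding linearized value satisfies `h(x + d*) = 1 + x - 1/μ > 1`. -/
theorem prox_subproblem_counterexample (h : ℝ → ℝ)
    (hdef : ∀ c : ℝ, h c = if c ≤ 0 then -c else 1 + c)
    (μ x : ℝ) (hμ : 0 < μ) (hx : 1 / μ + Real.sqrt (2 / μ) < x) :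
    (∀ d : ℝ, d ≠ -1 / μ →
      h (x + -1 / μ) + μ / 2 * (-1 / μ) ^ 2 < h (x + d) + μ / 2 * d ^ 2) ∧
    h (x + -1 / μ) + μ / 2 * (-1 / μ) ^ 2 = 1 + x - 1 / (2 * μ) ∧
    h (x + -1 / μ) = 1 + x - 1 / μ ∧
    1 < 1 + x - 1 / μ := by
  have hinv : 0 < 1 / μ := by positivity
  have hsqrt : 0 < Real.sqrt (2 / μ) := Real.sqrt_pos.mpr (by positivity)
  have hneg : -1 / μ = -(1 / μ) := neg_div μ 1
  have hval : h (x + -1 / μ) = 1 + x - 1 / μ := by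
    rw [hdef, if_neg (by rw [hneg]; linarith), hneg]
    ring
  have hmin : h (x + -1 / μ) + μ / 2 * (-1 / μ) ^ 2 = 1 + x - 1 / (2 * μ) := by
    rw [hval]
    field_simp
    ring
  refine ⟨fun d hd => ?_, hmin, hval, by linarith⟩
  rw [hmin, hdef]
  split_ifs with hxd
  · have hgap : 2 / μ < (x - 1 / μ) ^ 2 :=
      (Real.sqrt_lt' (by linarith)).mp (by linarith)
    have hquad : 1 < μ / 2 * (x - 1 / μ) ^ 2 :=
      calc (1 : ℝ) = μ / 2 * (2 / μ) := by field_simp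
        _ < μ / 2 * (x - 1 / μ) ^ 2 := by gcongr
    have hexpand : μ / 2 * (x - 1 / μ) ^ 2 = μ / 2 * x ^ 2 - x + 1 / (2 * μ) := by
      field_simp
      ring
    have hsq : x ^ 2 ≤ d ^ 2 := by nlinarith
    have hscaled : μ / 2 * x ^ 2 ≤ μ / 2 * d ^ 2 := by gcongr
    linarith
  · have hne : d + 1 / μ ≠ 0 := fun h0 => hd (by rw [hneg]; linarith)
    have hpos : 0 < μ / 2 * (d + 1 / μ) ^ 2 := by positivity
    have hexpand : μ / 2 * (d + 1 / μ) ^ 2 = μ / 2 * d ^ 2 + d + 1 / (2 * μ) := by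
      field_simp
      ring
    linarith
end

section
/- Let h : ℝᵐ → ℝ be convex, let A : ℝⁿ → ℝᵐ be a continuous linear map, let b ∈ ℝᵐ, and let μ > 0. Suppose there is no vector v ∈ ℝᵐ that is a subgradient of h at b and satisfies A* v = 0. Then the unique global minimizer d* of φ(d) = h(b + A d) + (μ/2)‖d‖² satisfies d* ≠ 0 and φ(d*) < φ(0) = h(b). -/
open RealInnerProductSpace

/-- If a convex function `h` attains its minimum over the affine subspace `b + range A` at `b`,
then some subgradient of `h` at `b` is annihilated by the adjoint of `A`. -/
theorem exists_isSubgradient_adjoint_eq_zero {n m : ℕ} {h : EuclideanSpace ℝ (Fin m) → ℝ}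
    (hconv : ConvexOn ℝ Set.univ h) (A : EuclideanSpace ℝ (Fin n) →L[ℝ] EuclideanSpace ℝ (Fin m))
    {b : EuclideanSpace ℝ (Fin m)} (hmin : ∀ d, h b ≤ h (b + A d)) :
    ∃ v, IsSubgradient h b v ∧ ContinuousLinearMap.adjoint A v = 0 := by
  have hcont : Continuous h := hconv.locallyLipschitz.continuous
  have hopen : IsOpen {p : EuclideanSpace ℝ (Fin m) × ℝ | p.1 ∈ Set.univ ∧ h p.1 < p.2} := by
    simpa using isOpen_lt (hcont.comp continuous_fst) continuous_snd
  have hconvt : Convex ℝ (Set.range fun d => ((b + A d, h b) : EuclideanSpace ℝ (Fin m) × ℝ)) := by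
    rintro _ ⟨d, rfl⟩ _ ⟨d', rfl⟩ s t _ _ hst
    refine ⟨s • d + t • d', Prod.ext ?_ ?_⟩
    · simp only [map_add, map_smul, Prod.fst_add, Prod.smul_fst]
      nth_rewrite 1 [← one_smul ℝ b]
      rw [← hst]
      module
    · simp [← add_mul, hst]
  obtain ⟨f, u, hlt, hle⟩ := geometric_hahn_banach_open hconv.convex_strict_epigraph hopen hconvt
    (Set.disjoint_left.2 (by
      rintro _ ⟨_, hp⟩ ⟨d, rfl⟩
      exact (hmin d).not_gt hp))
  let g := f.comp (ContinuousLinearMap.inl ℝ (EuclideanSpace ℝ (Fin m)) ℝ)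
  let c := f (0, 1)
  have hf (x : EuclideanSpace ℝ (Fin m)) (r : ℝ) : f (x, r) = g x + r * c := by
    have hxr : (x, r) = (x, 0) + r • ((0, 1) : EuclideanSpace ℝ (Fin m) × ℝ) := by simp
    rw [hxr, map_add, map_smul]
    rfl
  have hlt (x : EuclideanSpace ℝ (Fin m)) (r : ℝ) (hr : h x < r) : g x + r * c < u :=
    hf x r ▸ hlt (x, r) ⟨trivial, hr⟩
  have hle (d : EuclideanSpace ℝ (Fin n)) : u ≤ g b + g (A d) + h b * c := by
    rw [← map_add, ← hf]
    exact hle _ ⟨d, rfl⟩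
  have hb : u ≤ g b + h b * c := by simpa using hle 0
  have hc : c < 0 := by linarith [hlt b (h b + 1) (by linarith)]
  have hgA (d : EuclideanSpace ℝ (Fin n)) : g (A d) = 0 := by
    by_contra hne
    have := hle (((u - g b - h b * c - 1) / g (A d)) • d)
    rw [map_smul, map_smul, smul_eq_mul, div_mul_cancel₀ _ hne] at this
    linarith
  have hsub (x : EuclideanSpace ℝ (Fin m)) : g x + h x * c ≤ g b + h b * c := by
    refine le_of_forall_pos_le_add fun ε hε => ?_
    have := hlt x (h x + ε / -c) (by linarith [div_pos hε (neg_pos.2 hc)])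
    have hεc : ε / -c * c = -ε := by rw [div_neg, neg_mul, div_mul_cancel₀ _ hc.ne]
    linarith
  let w := (InnerProductSpace.toDual ℝ (EuclideanSpace ℝ (Fin m))).symm g
  have hw (x : EuclideanSpace ℝ (Fin m)) : ⟪w, x⟫ = g x :=
    InnerProductSpace.toDual_symm_apply
  refine ⟨(-c)⁻¹ • w, fun x => ?_, ext_inner_right ℝ fun d => ?_⟩
  · rw [real_inner_smul_left, hw, map_sub, ← le_sub_iff_add_le', inv_mul_le_iff₀ (neg_pos.2 hc)]
    linarith [hsub x]
  · rw [ContinuousLinearMap.adjoint_inner_left, real_inner_smul_left, hw, hgA, mul_zero,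
      inner_zero_left]

/-- If `0` minimizes the proximal perturbation `d ↦ h (b + A d) + μ / 2 * ‖d‖ ^ 2` of a convex
function, then it minimizes `d ↦ h (b + A d)`. -/
theorem ConvexOn.le_of_le_add_sq_norm {E F : Type*} [NormedAddCommGroup E] [NormedSpace ℝ E]
    [AddCommGroup F] [Module ℝ F] {h : F → ℝ} (hconv : ConvexOn ℝ Set.univ h) (A : E →ₗ[ℝ] F)
    {b : F} {μ : ℝ} (hmin : ∀ d, h b ≤ h (b + A d) + μ / 2 * ‖d‖ ^ 2) (d : E) :
    h b ≤ h (b + A d) := by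
  have hscale : ∀ t ∈ Set.Ioo (0 : ℝ) 1, h b ≤ h (b + A d) + t * (μ / 2 * ‖d‖ ^ 2) := by
    rintro t ⟨ht0, ht1⟩
    have hcomb := hconv.2 (Set.mem_univ b) (Set.mem_univ (b + A d)) (sub_nonneg.2 ht1.le) ht0.le
      (sub_add_cancel 1 t)
    have hpt : (1 - t) • b + t • (b + A d) = b + A (t • d) := by
      rw [map_smul]
      module
    have hbt := hmin (t • d)
    rw [norm_smul, Real.norm_of_nonneg ht0.le] at hbt
    rw [hpt, smul_eq_mul, smul_eq_mul] at hcomb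
    refine le_of_mul_le_mul_left ?_ ht0
    linarith
  have hlim : Filter.Tendsto (fun t : ℝ => h (b + A d) + t * (μ / 2 * ‖d‖ ^ 2))
      (nhdsWithin 0 (Set.Ioi 0)) (nhds (h (b + A d))) := by
    refine Filter.Tendsto.mono_left ?_ nhdsWithin_le_nhds
    exact Continuous.tendsto' (by fun_prop) _ _ (by simp)
  exact ge_of_tendsto hlim (Filter.eventually_of_mem (Ioo_mem_nhdsGT one_pos) hscale)

/-- **Strict decrease at noncritical data.** Let `h` be convex, `μ > 0`, and suppose no
subgradient `v` of `h` at `b` satisfies `A* v = 0`.  Then the unique global minimizer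
`d*` of `φ(d) = h(b + A d) + (μ/2)‖d‖²` is nonzero and `φ(d*) < φ(0) = h(b)`. -/
theorem prox_step_nonzero_strict_decrease (n m : ℕ)
    (h : EuclideanSpace ℝ (Fin m) → ℝ) (hconv : ConvexOn ℝ Set.univ h)
    (A : EuclideanSpace ℝ (Fin n) →L[ℝ] EuclideanSpace ℝ (Fin m))
    (b : EuclideanSpace ℝ (Fin m)) (μ : ℝ) (hμ : 0 < μ)
    (hnoncrit : ¬ ∃ v, IsSubgradient h b v ∧ ContinuousLinearMap.adjoint A v = 0) :
    ∀ dstar : EuclideanSpace ℝ (Fin n),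
      (∀ d', h (b + A dstar) + μ / 2 * ‖dstar‖ ^ 2 ≤ h (b + A d') + μ / 2 * ‖d'‖ ^ 2) →
      dstar ≠ 0 ∧ h (b + A dstar) + μ / 2 * ‖dstar‖ ^ 2 < h b := by
  intro dstar hstar
  have hlt : h (b + A dstar) + μ / 2 * ‖dstar‖ ^ 2 < h b := by
    by_contra! hge
    exact hnoncrit (exists_isSubgradient_adjoint_eq_zero hconv A
      (hconv.le_of_le_add_sq_norm A.toLinearMap fun d => hge.trans (hstar d)))
  refine ⟨?_, hlt⟩
  rintro rfl
  simp at hlt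
end

section
/- Let c : ℝⁿ → ℝᵐ be continuously differentiable on a neighborhood of x̄ ∈ ℝⁿ and let h : ℝᵐ → ℝ be convex. Suppose there is no vector v ∈ ℝᵐ that is a subgradient of h at c(x̄) and satisfies Dc(x̄)* v = 0. Then for every constant μ_max ≥ 0 there exists ε > 0 with the following property: for all sequences x_r → x̄, μ_r ∈ [0, μ_max], and d_r ∈ ℝⁿ such that for each r there exists v_r ∈ ℝᵐ that is a subgradient of h at c(x_r) + Dc(x_r) d_r with Dc(x_r)* v_r + μ_r d_r = 0, and such that h(c(x_r) + Dc(x_r) d_r) + (μ_r/2)‖d_r‖² ≤ h(c(x_r)), one has liminf_r ‖d_r‖ ≥ ε. -/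
open Filter Topology RealInnerProductSpace

theorem IsSubgradient.norm_le {m : ℕ} {h : EuclideanSpace ℝ (Fin m) → ℝ}
    {y v : EuclideanSpace ℝ (Fin m)} (hv : IsSubgradient h y v) {M : ℝ}
    (hM : ∀ z ∈ Metric.closedBall y 1, |h z| ≤ M) : ‖v‖ ≤ 2 * M := by
  have hy := abs_le.1 (hM y (Metric.mem_closedBall_self zero_le_one))
  rcases eq_or_ne v 0 with rfl | hv0
  · rw [norm_zero]
    linarith
  · have hpos : ‖v‖ ≠ 0 := norm_ne_zero_iff.2 hv0
    have hz := abs_le.1 (hM (y + ‖v‖⁻¹ • v) (by simp [norm_smul, hpos]))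
    have hsub := hv (y + ‖v‖⁻¹ • v)
    rw [add_sub_cancel_left, real_inner_smul_right, real_inner_self_eq_norm_sq, sq,
      inv_mul_cancel_left₀ hpos] at hsub
    linarith

/-- Subgradients of a continuous function along a convergent sequence are bounded. -/
theorem exists_norm_le_of_isSubgradient_of_tendsto {m : ℕ} {h : EuclideanSpace ℝ (Fin m) → ℝ}
    (hh : Continuous h) {y v : ℕ → EuclideanSpace ℝ (Fin m)} {y₀ : EuclideanSpace ℝ (Fin m)}
    (hy : Tendsto y atTop (𝓝 y₀)) (hv : ∀ k, IsSubgradient h (y k) (v k)) :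
    ∃ K, ∀ k, ‖v k‖ ≤ K := by
  obtain ⟨R, hR⟩ := (Metric.isBounded_range_of_tendsto y hy).subset_closedBall y₀
  obtain ⟨M, hM⟩ := (isCompact_closedBall y₀ (R + 1)).exists_bound_of_continuousOn hh.continuousOn
  refine ⟨2 * M, fun k => (hv k).norm_le fun z hz => hM z ?_⟩
  have hyk : dist (y k) y₀ ≤ R := hR (Set.mem_range_self k)
  have hzk : dist z (y k) ≤ 1 := hz
  have := dist_triangle z (y k) y₀
  exact Metric.mem_closedBall.2 (by linarith)

/-- The graph of the subdifferential of a continuous function is sequentially closed. -/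
theorem isSubgradient_of_tendsto {m : ℕ} {h : EuclideanSpace ℝ (Fin m) → ℝ}
    (hh : Continuous h) {y v : ℕ → EuclideanSpace ℝ (Fin m)} {y₀ v₀ : EuclideanSpace ℝ (Fin m)}
    (hy : Tendsto y atTop (𝓝 y₀)) (hv : Tendsto v atTop (𝓝 v₀))
    (hsub : ∀ k, IsSubgradient h (y k) (v k)) : IsSubgradient h y₀ v₀ := fun z =>
  le_of_tendsto
    (((hh.tendsto y₀).comp hy).add (hv.inner (tendsto_const_nhds.sub hy)))
    (Eventually.of_forall fun k => hsub k z)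

theorem tendsto_clm_apply {α E F : Type*} [NormedAddCommGroup E] [NormedSpace ℝ E]
    [NormedAddCommGroup F] [NormedSpace ℝ F] {l : Filter α} {A : α → E →L[ℝ] F} {u : α → E}
    {A₀ : E →L[ℝ] F} {u₀ : E} (hA : Tendsto A l (𝓝 A₀)) (hu : Tendsto u l (𝓝 u₀)) :
    Tendsto (fun k => A k (u k)) l (𝓝 (A₀ u₀)) :=
  (isBoundedBilinearMap_apply.continuous.tendsto (A₀, u₀)).comp (hA.prodMk_nhds hu)

/-- Near a noncritical point, no sufficiently short step is critical for a proximal linearized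
subproblem with bounded parameter. -/
theorem exists_forall_le_norm_of_noncritical {n m : ℕ}
    {c : EuclideanSpace ℝ (Fin n) → EuclideanSpace ℝ (Fin m)}
    {h : EuclideanSpace ℝ (Fin m) → ℝ} {xbar : EuclideanSpace ℝ (Fin n)}
    (hc : ContDiffAt ℝ 1 c xbar) (hh : Continuous h)
    (hnoncrit : ¬ ∃ v, IsSubgradient h (c xbar) v ∧
      ContinuousLinearMap.adjoint (fderiv ℝ c xbar) v = 0) (μmax : ℝ) :
    ∃ ε > (0 : ℝ), ∀ x d v, ∀ μ ∈ Set.Icc (0 : ℝ) μmax, dist x xbar < ε →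
      IsSubgradient h (c x + fderiv ℝ c x d) v →
      ContinuousLinearMap.adjoint (fderiv ℝ c x) v + μ • d = 0 → ε ≤ ‖d‖ := by
  by_contra! H
  choose x d v μ hμ hx hsub hcrit hd using
    fun k : ℕ => H (1 / ((k : ℝ) + 1)) Nat.one_div_pos_of_nat
  have hx₀ : Tendsto x atTop (𝓝 xbar) :=
    tendsto_iff_dist_tendsto_zero.2 (squeeze_zero (fun _ => dist_nonneg) (fun k => (hx k).le)
      tendsto_one_div_add_atTop_nhds_zero_nat)
  have hd₀ : Tendsto d atTop (𝓝 0) :=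
    squeeze_zero_norm (fun k => (hd k).le) tendsto_one_div_add_atTop_nhds_zero_nat
  have hD : Tendsto (fun k => fderiv ℝ c (x k)) atTop (𝓝 (fderiv ℝ c xbar)) :=
    (hc.continuousAt_fderiv one_ne_zero).tendsto.comp hx₀
  have hy : Tendsto (fun k => c (x k) + fderiv ℝ c (x k) (d k)) atTop (𝓝 (c xbar)) := by
    simpa using (hc.continuousAt.tendsto.comp hx₀).add (tendsto_clm_apply hD hd₀)
  obtain ⟨K, hK⟩ := exists_norm_le_of_isSubgradient_of_tendsto hh hy hsub
  obtain ⟨v₀, -, φ, hφ, hv₀⟩ := tendsto_subseq_of_bounded (Metric.isBounded_closedBall (x := 0))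
    (fun k => mem_closedBall_zero_iff.2 (hK k))
  have hμd : Tendsto (fun k => μ k • d k) atTop (𝓝 0) := by
    refine squeeze_zero_norm (a := fun k => μmax * ‖d k‖) (fun k => ?_)
      (by simpa using hd₀.norm.const_mul μmax)
    rw [norm_smul, Real.norm_of_nonneg (hμ k).1]
    exact mul_le_mul_of_nonneg_right (hμ k).2 (norm_nonneg _)
  have hadj : Tendsto (fun k => ContinuousLinearMap.adjoint (fderiv ℝ c (x k))) atTop
      (𝓝 (ContinuousLinearMap.adjoint (fderiv ℝ c xbar))) :=
    (ContinuousLinearMap.adjoint.continuous.tendsto _).comp hD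
  have hlim := (tendsto_clm_apply (hadj.comp hφ.tendsto_atTop) hv₀).add (hμd.comp hφ.tendsto_atTop)
  refine hnoncrit ⟨v₀, isSubgradient_of_tendsto hh (hy.comp hφ.tendsto_atTop) hv₀
    fun k => hsub (φ k), ?_⟩
  rw [add_zero] at hlim
  exact tendsto_nhds_unique hlim
    (tendsto_const_nhds.congr fun k => (hcrit (φ k)).symm)

/-- **Steps do not vanish near a noncritical point.** Let `c` be `C¹` near `x̄`, `h` be
convex, and suppose no subgradient `v` of `h` at `c(x̄)` satisfies `Dc(x̄)* v = 0`.
Then for any bound `μ_max ≥ 0` there is `ε > 0` such that for all sequences `x_r → x̄`,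
`μ_r ∈ [0, μ_max]`, and critical points `d_r` of the proximal linearized subproblems
(i.e. admitting multipliers `v_r`) whose objective value does not exceed that of `d = 0`,
one has `liminf_r ‖d_r‖ ≥ ε`. -/
theorem steps_bounded_below_near_noncritical (n m : ℕ)
    (c : EuclideanSpace ℝ (Fin n) → EuclideanSpace ℝ (Fin m))
    (h : EuclideanSpace ℝ (Fin m) → ℝ)
    (xbar : EuclideanSpace ℝ (Fin n))
    (hc : ContDiffAt ℝ 1 c xbar)
    (hconv : ConvexOn ℝ Set.univ h)
    (hnoncrit : ¬ ∃ v, IsSubgradient h (c xbar) v ∧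
      ContinuousLinearMap.adjoint (fderiv ℝ c xbar) v = 0) :
    ∀ μmax : ℝ, 0 ≤ μmax → ∃ ε > (0:ℝ),
      ∀ (xr : ℕ → EuclideanSpace ℝ (Fin n)) (μr : ℕ → ℝ)
        (dr : ℕ → EuclideanSpace ℝ (Fin n)),
        Tendsto xr atTop (𝓝 xbar) →
        (∀ r, μr r ∈ Set.Icc (0:ℝ) μmax) →
        (∀ r, ∃ vr, IsSubgradient h (c (xr r) + fderiv ℝ c (xr r) (dr r)) vr ∧
          ContinuousLinearMap.adjoint (fderiv ℝ c (xr r)) vr + μr r • dr r = 0) →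
        (∀ r, h (c (xr r) + fderiv ℝ c (xr r) (dr r)) + μr r / 2 * ‖dr r‖ ^ 2 ≤
          h (c (xr r))) →
        ENNReal.ofReal ε ≤ Filter.liminf (fun r => ENNReal.ofReal ‖dr r‖) atTop := by
  intro μmax _
  obtain ⟨ε, hε, H⟩ := exists_forall_le_norm_of_noncritical hc
    hconv.locallyLipschitz.continuous hnoncrit μmax
  refine ⟨ε, hε, fun xr μr dr hx hμ hcrit _ => le_liminf_of_le (by isBoundedDefault) ?_⟩
  filter_upwards [hx.eventually (Metric.ball_mem_nhds xbar hε)] with r hr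
  obtain ⟨v, hv, hv0⟩ := hcrit r
  exact ENNReal.ofReal_le_ofReal (H _ _ v _ (hμ r) hr hv hv0)
end

section
/- Let c : ℝⁿ → ℝᵐ be twice continuously differentiable on a neighborhood of x̄ ∈ ℝⁿ, let h : ℝᵐ → ℝ be convex, write c̄ = c(x̄), and suppose the criticality condition holds: there exists v ∈ ∂h(c̄) with Dc(x̄)* v = 0. Suppose in addition the constraint qualification holds: the only vector lying both in the linear span of {v − w : v, w ∈ ∂h(c̄)} and in the kernel of Dc(x̄)* is 0. Then: (i) there is exactly one vector v̄ with v̄ ∈ ∂h(c̄) and Dc(x̄)* v̄ = 0; and (ii) for any constant C ≥ 0 and any sequences μ_r > 0, x_r → x̄ with μ_r ‖x_r − x̄‖ → 0, d_r ∈ ℝⁿ with ‖d_r‖ ≤ C‖x_r − x̄‖, and v_r ∈ ∂h(c(x_r) + Dc(x_r) d_r) with Dc(x_r)* v_r + μ_r d_r = 0, one has v_r → v̄. -/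
open Filter Topology RealInnerProductSpace

/-- Near a point where a function is Lipschitz, its subgradients are bounded by the Lipschitz
constant. -/
lemma IsSubgradient.norm_le_s13 {m : ℕ} {h : EuclideanSpace ℝ (Fin m) → ℝ}
    {c₀ v : EuclideanSpace ℝ (Fin m)} (hv : IsSubgradient h c₀ v) {K : NNReal}
    {s : Set (EuclideanSpace ℝ (Fin m))} (hK : LipschitzOnWith K h s) (hs : s ∈ 𝓝 c₀) :
    ‖v‖ ≤ K := by
  have hlim : Tendsto (fun t : ℝ => c₀ + t • v) (𝓝[>] 0) (𝓝 c₀) := by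
    have : Continuous fun t : ℝ => c₀ + t • v := by fun_prop
    simpa using (this.tendsto 0).mono_left nhdsWithin_le_nhds
  obtain ⟨t, hts, ht⟩ := ((hlim.eventually hs).and self_mem_nhdsWithin).exists
  have ht : 0 < t := ht
  have hsub := hv (c₀ + t • v)
  have hlip := hK.dist_le_mul _ hts _ (mem_of_mem_nhds hs)
  rw [add_sub_cancel_left, real_inner_smul_right, real_inner_self_eq_norm_sq] at hsub
  rw [Real.dist_eq, dist_eq_norm, add_sub_cancel_left, norm_smul, Real.norm_of_nonneg ht.le]
    at hlip
  have hle := (le_abs_self _).trans hlip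
  rcases (norm_nonneg v).eq_or_lt with h0 | h0
  · rw [← h0]
    exact K.2
  · have hpos : 0 < t * ‖v‖ := mul_pos ht h0
    refine le_of_mul_le_mul_right ?_ hpos
    nlinarith

/-- The graph of the subdifferential of a continuous function is closed. -/
lemma IsSubgradient.of_tendsto {m : ℕ} {h : EuclideanSpace ℝ (Fin m) → ℝ} (hcont : Continuous h)
    {ι : Type*} {l : Filter ι} [l.NeBot] {y w : ι → EuclideanSpace ℝ (Fin m)}
    {c₀ v : EuclideanSpace ℝ (Fin m)} (hy : Tendsto y l (𝓝 c₀)) (hw : Tendsto w l (𝓝 v))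
    (hsub : ∀ i, IsSubgradient h (y i) (w i)) : IsSubgradient h c₀ v := fun c' =>
  le_of_tendsto (((hcont.tendsto c₀).comp hy).add (hw.inner (tendsto_const_nhds.sub hy)))
    (Eventually.of_forall fun i => hsub i c')

/-- Evaluation of continuous linear maps is jointly continuous along a filter. -/
lemma ContinuousLinearMap.tendsto_apply {E F ι : Type*} [NormedAddCommGroup E] [NormedSpace ℝ E]
    [NormedAddCommGroup F] [NormedSpace ℝ F] {l : Filter ι} {A : ι → E →L[ℝ] F} {x : ι → E}
    {A₀ : E →L[ℝ] F} {x₀ : E} (hA : Tendsto A l (𝓝 A₀)) (hx : Tendsto x l (𝓝 x₀)) :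
    Tendsto (fun i => A i (x i)) l (𝓝 (A₀ x₀)) :=
  (isBoundedBilinearMap_apply.continuous.tendsto (A₀, x₀)).comp (hA.prodMk_nhds hx)

/-- **Uniqueness and convergence of multipliers.** Let `c` be `C²` near `x̄`, `h` be
convex, and assume criticality of `h ∘ c` at `x̄` and the constraint qualification:
the only vector in both the span of differences of subgradients of `h` at `c̄ = c(x̄)`
(the subspace parallel to the affine span of `∂h(c̄)`) and the kernel of `Dc(x̄)*` is `0`.
Then the multiplier `v̄ ∈ ∂h(c̄) ∩ Null Dc(x̄)*` is unique, and any sequence of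
multipliers `v_r` for the proximal linearized subproblems along `x_r → x̄` with
`μ_r ‖x_r - x̄‖ → 0` and `‖d_r‖ ≤ C‖x_r - x̄‖` converges to `v̄`. -/
theorem multipliers_unique_and_converge (n m : ℕ)
    (c : EuclideanSpace ℝ (Fin n) → EuclideanSpace ℝ (Fin m))
    (h : EuclideanSpace ℝ (Fin m) → ℝ)
    (xbar : EuclideanSpace ℝ (Fin n))
    (hc : ContDiffAt ℝ 2 c xbar)
    (hconv : ConvexOn ℝ Set.univ h)
    (hcrit : ∃ v, IsSubgradient h (c xbar) v ∧
      ContinuousLinearMap.adjoint (fderiv ℝ c xbar) v = 0)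
    (hCQ : ∀ u : EuclideanSpace ℝ (Fin m),
      u ∈ Submodule.span ℝ {u' | ∃ v w, IsSubgradient h (c xbar) v ∧
        IsSubgradient h (c xbar) w ∧ u' = v - w} →
      ContinuousLinearMap.adjoint (fderiv ℝ c xbar) u = 0 → u = 0) :
    (∃! vbar, IsSubgradient h (c xbar) vbar ∧
      ContinuousLinearMap.adjoint (fderiv ℝ c xbar) vbar = 0) ∧
    (∀ vbar, (IsSubgradient h (c xbar) vbar ∧
        ContinuousLinearMap.adjoint (fderiv ℝ c xbar) vbar = 0) →
      ∀ C : ℝ, 0 ≤ C →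
      ∀ (μr : ℕ → ℝ) (xr : ℕ → EuclideanSpace ℝ (Fin n))
        (dr : ℕ → EuclideanSpace ℝ (Fin n)) (vr : ℕ → EuclideanSpace ℝ (Fin m)),
        (∀ r, 0 < μr r) →
        Tendsto xr atTop (𝓝 xbar) →
        Tendsto (fun r => μr r * ‖xr r - xbar‖) atTop (𝓝 0) →
        (∀ r, ‖dr r‖ ≤ C * ‖xr r - xbar‖) →
        (∀ r, IsSubgradient h (c (xr r) + fderiv ℝ c (xr r) (dr r)) (vr r) ∧
          ContinuousLinearMap.adjoint (fderiv ℝ c (xr r)) (vr r) + μr r • dr r = 0) →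
        Tendsto vr atTop (𝓝 vbar)) := by
  have huniq : ∀ v w, IsSubgradient h (c xbar) v →
      ContinuousLinearMap.adjoint (fderiv ℝ c xbar) v = 0 → IsSubgradient h (c xbar) w →
      ContinuousLinearMap.adjoint (fderiv ℝ c xbar) w = 0 → v = w := fun v w hv hv0 hw hw0 =>
    sub_eq_zero.1 (hCQ (v - w) (Submodule.subset_span ⟨v, w, hv, hw, rfl⟩)
      (by rw [map_sub, hv0, hw0, sub_zero]))
  refine ⟨?_, ?_⟩
  · obtain ⟨v, hv, hv0⟩ := hcrit
    exact ⟨v, ⟨hv, hv0⟩, fun w hw => huniq w v hw.1 hw.2 hv hv0⟩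
  rintro vbar ⟨hvbar, hvbar0⟩ C - μr xr dr vr hμ hx hμx hd hvr
  have hLip : LocallyLipschitz h := hconv.locallyLipschitz
  have hDc : Tendsto (fun r => fderiv ℝ c (xr r)) atTop (𝓝 (fderiv ℝ c xbar)) :=
    ((hc.fderiv_right (m := 1) (by norm_num)).continuousAt.tendsto).comp hx
  have hxn : Tendsto (fun r => ‖xr r - xbar‖) atTop (𝓝 0) :=
    tendsto_iff_norm_sub_tendsto_zero.1 hx
  have hd0 : Tendsto dr atTop (𝓝 0) :=
    squeeze_zero_norm hd (by simpa using hxn.const_mul C)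
  have hμd : Tendsto (fun r => μr r • dr r) atTop (𝓝 0) := by
    refine squeeze_zero_norm (fun r => ?_) (by simpa using hμx.const_mul C)
    rw [norm_smul, Real.norm_of_nonneg (hμ r).le]
    nlinarith [mul_le_mul_of_nonneg_left (hd r) (hμ r).le]
  have hy : Tendsto (fun r => c (xr r) + fderiv ℝ c (xr r) (dr r)) atTop (𝓝 (c xbar)) := by
    simpa using (hc.continuousAt.tendsto.comp hx).add (ContinuousLinearMap.tendsto_apply hDc hd0)
  obtain ⟨K, s, hs, hK⟩ := hLip (c xbar)
  refine IsCompact.tendsto_nhds_of_unique_mapClusterPt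
    (isCompact_closedBall (0 : EuclideanSpace ℝ (Fin m)) K) ?_ fun w _ hw => ?_
  · filter_upwards [hy.eventually (eventually_mem_nhds_iff.2 hs)] with r hr
    exact mem_closedBall_zero_iff.2 ((hvr r).1.norm_le_s13 hK hr)
  · obtain ⟨φ, hφ, hvφ⟩ := hw.tendsto_subseq
    have hφ := hφ.tendsto_atTop
    refine huniq w vbar ?_ ?_ hvbar hvbar0
    · exact IsSubgradient.of_tendsto hLip.continuous (hy.comp hφ) hvφ fun r => (hvr (φ r)).1
    · have hadj : Tendsto (fun r => ContinuousLinearMap.adjoint (fderiv ℝ c (xr (φ r))))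
          atTop (𝓝 (ContinuousLinearMap.adjoint (fderiv ℝ c xbar))) :=
        (ContinuousLinearMap.adjoint.continuous.tendsto _).comp (hDc.comp hφ)
      refine tendsto_nhds_unique (l := atTop)
        (f := fun _ : ℕ => (0 : EuclideanSpace ℝ (Fin n))) ?_ tendsto_const_nhds
      simpa [Function.comp_def, (hvr _).2] using (ContinuousLinearMap.tendsto_apply hadj hvφ).add (hμd.comp hφ)
end

section
/- Let F : ℝ^p → ℝ^q be continuously differentiable on a neighborhood of z̄ ∈ ℝ^p, let S ⊆ ℝ^q be a closed convex set with F(z̄) ∈ S, and suppose the only vector v ∈ ℝ^q satisfying both ⟪v, s − F(z̄)⟫ ≤ 0 for all s ∈ S and DF(z̄)* v = 0 is v = 0. Then there exists a constant κ > 0 such that for all z in some neighborhood of z̄, dist(z, F⁻¹(S)) ≤ κ · dist(F(z), S). -/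
open Filter Topology RealInnerProductSpace

section MetricRegularity

/-- A nearest point `y` of a convex set to `u` satisfies the obtuse angle condition. -/
theorem Convex.inner_sub_le_zero_of_infDist_eq {G : Type*} [NormedAddCommGroup G]
    [InnerProductSpace ℝ G] {S : Set G} (hS : Convex ℝ S) {u y : G}
    (hy : y ∈ S) (h : Metric.infDist u S = dist u y) (s : G) (hs : s ∈ S) :
    ⟪u - y, s - y⟫ ≤ 0 := by
  refine (norm_eq_iInf_iff_real_inner_le_zero hS hy).1 ?_ s hs
  rw [← dist_eq_norm, ← h, Metric.infDist_eq_iInf]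
  simp only [dist_eq_norm]

variable {E G : Type*} [NormedAddCommGroup E] [InnerProductSpace ℝ E] [FiniteDimensional ℝ E]
  [NormedAddCommGroup G] [InnerProductSpace ℝ G] [FiniteDimensional ℝ G]

/-- First-order condition at a point `w` where `‖F · - y‖ + k * ‖· - w‖` has a local minimum. -/
theorem norm_adjoint_le_of_eventually_norm_le {F : E → G} {F' : E →L[ℝ] G} {w : E} {y : G}
    {k : ℝ} (hk : 0 ≤ k) (hF : HasFDerivAt F F' w) (hne : F w ≠ y)
    (hmin : ∀ᶠ z in 𝓝 w, ‖F w - y‖ ≤ ‖F z - y‖ + k * ‖z - w‖) :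
    ‖ContinuousLinearMap.adjoint F' (F w - y)‖ ≤ k * ‖F w - y‖ := by
  set a := ContinuousLinearMap.adjoint F' (F w - y) with ha
  have hδ : 0 < ‖F w - y‖ := norm_pos_iff.2 (sub_ne_zero.2 hne)
  set δ := ‖F w - y‖ with hδ_def
  have hline : HasDerivAt (fun t : ℝ => w + t • (-a)) (-a) 0 := by
    simpa using ((hasDerivAt_id (0 : ℝ)).smul_const (-a)).const_add w
  have hF0 : HasFDerivAt F F' (w + (0 : ℝ) • (-a)) := by simpa using hF
  have hcomp : HasDerivAt (fun t : ℝ => F (w + t • (-a)) - y) (F' (-a)) 0 :=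
    (hF0.comp_hasDerivAt (0 : ℝ) hline).sub_const y
  have hlin : HasDerivAt (fun t : ℝ => δ - k * ‖a‖ * t) (-(k * ‖a‖)) 0 := by
    simpa using ((hasDerivAt_id (0 : ℝ)).const_mul (k * ‖a‖)).const_sub δ
  have hψ := hcomp.norm_sq.sub (hlin.pow 2)
  have hslope := (hasDerivWithinAt_iff_tendsto_slope' Set.self_notMem_Ioi).1
    (hψ.hasDerivWithinAt (s := Set.Ioi 0))
  have hnonneg := ge_of_tendsto (b := (0 : ℝ)) hslope (by
    have h1 : ∀ᶠ t : ℝ in 𝓝[>] 0, δ ≤ ‖F (w + t • (-a)) - y‖ + k * ‖w + t • (-a) - w‖ := by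
      have ht : Tendsto (fun t : ℝ => w + t • (-a)) (𝓝 0) (𝓝 w) := by
        simpa using hline.continuousAt.tendsto
      exact nhdsWithin_le_nhds (ht.eventually hmin)
    have h2 : ∀ᶠ t : ℝ in 𝓝[>] 0, 0 < δ - k * ‖a‖ * t := by
      refine nhdsWithin_le_nhds (hlin.continuousAt.eventually (lt_mem_nhds ?_))
      simpa using hδ
    filter_upwards [h1, h2, self_mem_nhdsWithin] with t ht1 ht2 ht
    have ht : 0 < t := ht
    rw [slope_def_field]
    have hn : ‖w + t • (-a) - w‖ = t * ‖a‖ := by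
      rw [add_sub_cancel_left, norm_smul, norm_neg, Real.norm_of_nonneg ht.le]
    rw [hn] at ht1
    have hsq := pow_le_pow_left₀ ht2.le
      (show δ - k * ‖a‖ * t ≤ ‖F (w + t • (-a)) - y‖ by linarith) 2
    refine div_nonneg ?_ (by linarith)
    simpa [← hδ_def] using hsq)
  have hin : ⟪F w - y, F' a⟫ = ‖a‖ ^ 2 := by
    rw [← ContinuousLinearMap.adjoint_inner_left, ← ha, real_inner_self_eq_norm_sq]
  simp only [zero_smul, add_zero, map_neg, inner_neg_right, hin] at hnonneg
  norm_num at hnonneg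
  by_contra! hcon
  have ha1 : 0 < ‖a‖ := (mul_nonneg hk hδ.le).trans_lt hcon
  nlinarith [mul_lt_mul_of_pos_left hcon ha1]

/-- Stability of the transversality condition: it persists, with a uniform constant, at points
near `z₀` and for the normals generated by nearest points. -/
theorem exists_pos_eventually_mul_norm_le_norm_adjoint {F : E → G} {z₀ : E} {S : Set G}
    (hF : ContDiffAt ℝ 1 F z₀) (hS : Convex ℝ S) (hz₀ : F z₀ ∈ S)
    (htrans : ∀ v : G, (∀ s ∈ S, ⟪v, s - F z₀⟫ ≤ 0) →
      ContinuousLinearMap.adjoint (fderiv ℝ F z₀) v = 0 → v = 0) :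
    ∃ c > (0 : ℝ), ∀ᶠ z in 𝓝 z₀, ∀ y ∈ S, Metric.infDist (F z) S = dist (F z) y →
      c * ‖F z - y‖ ≤ ‖ContinuousLinearMap.adjoint (fderiv ℝ F z) (F z - y)‖ := by
  have hfd : ContinuousAt (fderiv ℝ F) z₀ :=
    (hF.fderiv_right (m := 0) (by norm_num)).continuousAt
  have key : ∀ᶠ x : ℝ × E × G in 𝓝 (0, z₀, F z₀), ∀ v ∈ Metric.sphere (0 : G) 1,
      (∃ s ∈ S, 0 < ⟪v, s - x.2.2⟫) ∨
        x.1 < ‖ContinuousLinearMap.adjoint (fderiv ℝ F x.2.1) v‖ := by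
    refine (isCompact_sphere (0 : G) 1).eventually_forall_of_forall_eventually fun v hv => ?_
    by_cases h : ∀ s ∈ S, ⟪v, s - F z₀⟫ ≤ 0
    · have hne : ContinuousLinearMap.adjoint (fderiv ℝ F z₀) v ≠ 0 := by
        intro h0
        have := htrans v h h0
        simp [this] at hv
      have hfd' : ContinuousAt (fun x : (ℝ × E × G) × G => fderiv ℝ F x.1.2.1)
          ((0, z₀, F z₀), v) :=
        ContinuousAt.comp (g := fderiv ℝ F) (f := fun x : (ℝ × E × G) × G => x.1.2.1)
          hfd (by fun_prop)
      have hadj : ContinuousAt (fun x : (ℝ × E × G) × G =>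
          ContinuousLinearMap.adjoint (fderiv ℝ F x.1.2.1)) ((0, z₀, F z₀), v) :=
        ContinuousAt.comp (g := fun A : E →L[ℝ] G => ContinuousLinearMap.adjoint A)
          (ContinuousLinearMap.adjoint (𝕜 := ℝ) (E := E) (F := G)).continuous.continuousAt hfd'
      have hev := ContinuousAt.eventually_lt
        (f := fun x : (ℝ × E × G) × G => x.1.1)
        (g := fun x => ‖ContinuousLinearMap.adjoint (fderiv ℝ F x.1.2.1) x.2‖)
        (x₀ := ((0, z₀, F z₀), v)) (by fun_prop) (hadj.clm_apply continuousAt_snd).norm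
        (by simpa using hne)
      exact hev.mono fun x hx => Or.inr hx
    · push Not at h
      obtain ⟨s, hs, hpos⟩ := h
      have hev := ContinuousAt.eventually_lt
        (f := fun _ : (ℝ × E × G) × G => (0 : ℝ))
        (g := fun x => ⟪x.2, s - x.1.2.2⟫)
        (x₀ := ((0, z₀, F z₀), v)) (by fun_prop) (by fun_prop) hpos
      exact hev.mono fun x hx => Or.inl ⟨s, hs, hx⟩
  rw [nhds_prod_eq, nhds_prod_eq] at key
  obtain ⟨P, hP, Q, hQ, hPQ⟩ := eventually_prod_iff.1 key
  obtain ⟨A, hA, B, hB, hAB⟩ := eventually_prod_iff.1 hQ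
  obtain ⟨c, hPc, hc⟩ := ((hP.filter_mono nhdsWithin_le_nhds).and self_mem_nhdsWithin :
    ∀ᶠ c in 𝓝[>] (0 : ℝ), P c ∧ c ∈ Set.Ioi (0 : ℝ)).exists
  refine ⟨c, hc, ?_⟩
  obtain ⟨ε, hε, hBε⟩ := Metric.eventually_nhds_iff.1 hB
  filter_upwards [hA, hF.continuousAt.eventually (Metric.ball_mem_nhds (F z₀) (half_pos hε))]
    with z hz hFz y hy hdist
  rcases eq_or_ne (F z) y with heq | hne
  · simp [heq]
  have hpos : 0 < ‖F z - y‖ := norm_pos_iff.2 (sub_ne_zero.2 hne)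
  have hBy : B y := by
    refine hBε ?_
    have h1 : dist (F z) y ≤ dist (F z) (F z₀) := hdist ▸ Metric.infDist_le_dist_of_mem hz₀
    have h2 : dist (F z) (F z₀) < ε / 2 := hFz
    linarith [dist_triangle_left y (F z₀) (F z)]
  have hx := hPQ hPc (hAB hz hBy) (‖F z - y‖⁻¹ • (F z - y))
    (by simp [norm_smul, inv_mul_cancel₀ hpos.ne'])
  rcases hx with ⟨s, hs, hlt⟩ | hlt
  · rw [real_inner_smul_left] at hlt
    have := hS.inner_sub_le_zero_of_infDist_eq hy hdist s hs
    exact absurd hlt (not_lt.2 (mul_nonpos_of_nonneg_of_nonpos (inv_nonneg.2 hpos.le) this))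
  · rw [map_smul, norm_smul, norm_inv, norm_norm, inv_mul_eq_div, lt_div_iff₀ hpos] at hlt
    exact hlt.le

/-- Metric regularity of the constraint `F z ∈ S` in finite-dimensional inner product spaces. -/
theorem exists_pos_eventually_infDist_preimage_le {F : E → G} {z₀ : E} {S : Set G}
    (hF : ContDiffAt ℝ 1 F z₀) (hSc : IsClosed S) (hS : Convex ℝ S) (hz₀ : F z₀ ∈ S)
    (htrans : ∀ v : G, (∀ s ∈ S, ⟪v, s - F z₀⟫ ≤ 0) →
      ContinuousLinearMap.adjoint (fderiv ℝ F z₀) v = 0 → v = 0) :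
    ∃ κ > (0 : ℝ), ∀ᶠ z in 𝓝 z₀,
      Metric.infDist z (F ⁻¹' S) ≤ κ * Metric.infDist (F z) S := by
  obtain ⟨c, hc, hcz⟩ := exists_pos_eventually_mul_norm_le_norm_adjoint hF hS hz₀ htrans
  have hdiff : ∀ᶠ z in 𝓝 z₀, DifferentiableAt ℝ F z :=
    (hF.eventually (by simp)).mono fun z hz => hz.differentiableAt (by simp)
  obtain ⟨r, hr, hball⟩ := Metric.nhds_basis_closedBall.eventually_iff.1 (hcz.and hdiff)
  have hSne : S.Nonempty := ⟨_, hz₀⟩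
  have hd : ContinuousAt (fun z => Metric.infDist (F z) S) z₀ :=
    (Metric.continuous_infDist_pt S).continuousAt.comp hF.continuousAt
  refine ⟨2 / c, by positivity, ?_⟩
  have hsmall : ∀ᶠ z in 𝓝 z₀, 2 / c * Metric.infDist (F z) S < r / 2 := by
    refine (hd.const_mul (2 / c)).eventually (gt_mem_nhds ?_)
    simpa [Metric.infDist_zero_of_mem hz₀] using hr
  filter_upwards [hsmall, Metric.ball_mem_nhds z₀ (half_pos hr)] with x hx hxr
  have hxr : dist x z₀ < r / 2 := hxr
  obtain ⟨w, hw, hmin⟩ := (isCompact_closedBall z₀ r).exists_isMinOn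
    (f := fun z => Metric.infDist (F z) S + c / 2 * ‖z - x‖) ⟨z₀, by simp [hr.le]⟩ (by
      intro z hz
      have := (hball hz).2.continuousAt
      have h' : ContinuousAt (fun z => Metric.infDist (F z) S) z :=
        (Metric.continuous_infDist_pt S).continuousAt.comp this
      exact (h'.add (by fun_prop)).continuousWithinAt)
  have hmin' : ∀ z ∈ Metric.closedBall z₀ r, Metric.infDist (F w) S + c / 2 * ‖w - x‖ ≤
      Metric.infDist (F z) S + c / 2 * ‖z - x‖ := fun z hz => hmin hz
  have hwx : ‖w - x‖ ≤ 2 / c * Metric.infDist (F x) S := by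
    have h1 := hmin' x (by simp only [Metric.mem_closedBall]; linarith)
    have h2 : 0 ≤ Metric.infDist (F w) S := Metric.infDist_nonneg
    rw [sub_self, norm_zero, mul_zero, add_zero] at h1
    rw [div_mul_eq_mul_div, le_div_iff₀ hc]
    linarith
  have hwS : F w ∈ S := by
    by_contra hnot
    obtain ⟨y, hy, hdist⟩ := hSc.exists_infDist_eq_dist hSne (F w)
    have hne : F w ≠ y := fun h => hnot (h ▸ hy)
    have hwb : w ∈ Metric.ball z₀ r := by
      rw [Metric.mem_ball]
      have := dist_triangle w x z₀
      rw [dist_eq_norm w x] at this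
      linarith
    have hle := norm_adjoint_le_of_eventually_norm_le (half_pos hc).le
      (hball hw).2.hasFDerivAt hne (by
        filter_upwards [Metric.isOpen_ball.mem_nhds hwb] with z hz
        have h1 := hmin' z (Metric.ball_subset_closedBall hz)
        have h2 : Metric.infDist (F z) S ≤ dist (F z) y := Metric.infDist_le_dist_of_mem hy
        have h3 : ‖z - x‖ ≤ ‖z - w‖ + ‖w - x‖ := norm_sub_le_norm_sub_add_norm_sub z w x
        rw [hdist] at h1
        rw [dist_eq_norm] at h1 h2
        nlinarith [mul_le_mul_of_nonneg_left h3 (half_pos hc).le])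
    have hge := (hball hw).1 y hy hdist
    have hpos : 0 < ‖F w - y‖ := norm_pos_iff.2 (sub_ne_zero.2 hne)
    nlinarith [mul_pos hc hpos]
  calc Metric.infDist x (F ⁻¹' S) ≤ dist x w := Metric.infDist_le_dist_of_mem hwS
    _ = ‖w - x‖ := by rw [dist_comm, dist_eq_norm]
    _ ≤ _ := hwx

end MetricRegularity

/-- **Metric regularity of constraint systems (convex case).** Let `F` be `C¹` near `z̄`,
`S` a closed convex set with `F(z̄) ∈ S`, and suppose the only vector in both the normal
cone to `S` at `F(z̄)` and the kernel of `DF(z̄)*` is `0`.  Then for some `κ > 0` and all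
`z` near `z̄`, `dist(z, F⁻¹(S)) ≤ κ · dist(F(z), S)`. -/
theorem metric_regularity_constraint_system (p q : ℕ)
    (F : EuclideanSpace ℝ (Fin p) → EuclideanSpace ℝ (Fin q))
    (zbar : EuclideanSpace ℝ (Fin p))
    (S : Set (EuclideanSpace ℝ (Fin q)))
    (hF : ContDiffAt ℝ 1 F zbar)
    (hSclosed : IsClosed S) (hSconv : Convex ℝ S) (hzS : F zbar ∈ S)
    (htrans : ∀ v : EuclideanSpace ℝ (Fin q),
      (∀ s ∈ S, ⟪v, s - F zbar⟫ ≤ 0) →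
      ContinuousLinearMap.adjoint (fderiv ℝ F zbar) v = 0 → v = 0) :
    ∃ κ > (0:ℝ), ∀ᶠ z in 𝓝 zbar,
      Metric.infDist z (F ⁻¹' S) ≤ κ * Metric.infDist (F z) S := by
  exact exists_pos_eventually_infDist_preimage_le hF hSclosed hSconv hzS htrans
end

section
/- Let S ⊆ ℝ^q be a closed convex set with 0 ∈ S, and let Ā : ℝ^p → ℝ^q be a continuous linear map such that the only vector v ∈ ℝ^q satisfying both ⟪v, s⟫ ≤ 0 for all s ∈ S and Ā* v = 0 is v = 0. Then there exist constants γ > 0 and δ > 0 such that for every vector v ∈ ℝ^q with ‖v‖ < δ and every continuous linear map A : ℝ^p → ℝ^q with operator norm ‖A − Ā‖ < δ, the inclusion v + A u ∈ S has a solution u ∈ ℝ^p satisfying ‖u‖ ≤ γ ‖v‖. -/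
open RealInnerProductSpace

open Metric

section

variable {E F : Type*} [NormedAddCommGroup E] [InnerProductSpace ℝ E]
  [NormedAddCommGroup F] [InnerProductSpace ℝ F]

/-- If every nonzero `y` has positive inner product with some point of `K`, then in finite
dimension the positivity is uniform in the direction of `y`. -/
theorem exists_forall_mul_norm_le_inner [FiniteDimensional ℝ F] {K : Set F} (h0 : (0 : F) ∈ K)
    (hK : ∀ y : F, y ≠ 0 → ∃ z ∈ K, 0 < ⟪y, z⟫) :
    ∃ ε > (0 : ℝ), ∀ y : F, ∃ z ∈ K, ε * ‖y‖ ≤ ⟪y, z⟫ := by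
  have hsphere : ∃ ε > (0 : ℝ), ∀ y ∈ sphere (0 : F) 1, ∃ z ∈ K, ε ≤ ⟪y, z⟫ := by
    have : ProperSpace F := FiniteDimensional.proper ℝ F
    refine (isCompact_sphere (0 : F) 1).induction_on
      (p := fun T => ∃ ε > (0 : ℝ), ∀ y ∈ T, ∃ z ∈ K, ε ≤ ⟪y, z⟫) ⟨1, one_pos, by simp⟩ ?_ ?_ ?_
    · rintro s t hst ⟨ε, hε, h⟩
      exact ⟨ε, hε, fun y hy => h y (hst hy)⟩
    · rintro s t ⟨a, ha, hs⟩ ⟨b, hb, ht⟩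
      refine ⟨min a b, lt_min ha hb, ?_⟩
      rintro y (hy | hy)
      · obtain ⟨z, hz, h⟩ := hs y hy
        exact ⟨z, hz, (min_le_left _ _).trans h⟩
      · obtain ⟨z, hz, h⟩ := ht y hy
        exact ⟨z, hz, (min_le_right _ _).trans h⟩
    · intro y hy
      obtain ⟨z, hz, h⟩ := hK y (ne_zero_of_mem_unit_sphere ⟨y, hy⟩)
      refine ⟨{x | ⟪y, z⟫ / 2 < ⟪x, z⟫}, mem_nhdsWithin_of_mem_nhds ?_, ⟪y, z⟫ / 2, half_pos h,
        fun x hx => ⟨z, hz, le_of_lt hx⟩⟩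
      exact (isOpen_lt continuous_const (by fun_prop)).mem_nhds (half_lt_self h)
  obtain ⟨ε, hε, h⟩ := hsphere
  refine ⟨ε, hε, fun y => ?_⟩
  rcases eq_or_ne y 0 with rfl | hy
  · exact ⟨0, h0, by simp⟩
  · have hy' : 0 < ‖y‖ := norm_pos_iff.mpr hy
    obtain ⟨z, hz, hyz⟩ := h (‖y‖⁻¹ • y) (by simp [norm_smul, hy'.ne'])
    refine ⟨z, hz, ?_⟩
    rw [real_inner_smul_left, inv_mul_eq_div, le_div_iff₀ hy'] at hyz
    exact hyz

/-- A closed convex set whose support function dominates `ε * ‖·‖` contains the closed ball of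
radius `ε` about the origin. -/
theorem Convex.mem_of_forall_mul_norm_le_inner [CompleteSpace F] {C : Set F} (hC : Convex ℝ C)
    (hCc : IsClosed C) {ε : ℝ} (h : ∀ y : F, ∃ z ∈ C, ε * ‖y‖ ≤ ⟪y, z⟫) {w : F}
    (hw : ‖w‖ ≤ ε) : w ∈ C := by
  by_contra hwC
  obtain ⟨f, c, hfc, hcw⟩ := geometric_hahn_banach_closed_point hC hCc hwC
  obtain ⟨z, hz, hyz⟩ := h ((InnerProductSpace.toDual ℝ F).symm f)
  have hle := real_inner_le_norm ((InnerProductSpace.toDual ℝ F).symm f) w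
  rw [InnerProductSpace.toDual_symm_apply] at hyz hle
  have hmul := mul_le_mul_of_nonneg_left hw (norm_nonneg ((InnerProductSpace.toDual ℝ F).symm f))
  linarith [hfc z hz]

/-- The differences `s - A u` with `s ∈ S` and `u` both in the closed unit ball. -/
def unitDifferences (S : Set F) (A : E →L[ℝ] F) : Set F :=
  {z | ∃ s ∈ S ∩ closedBall 0 1, ∃ u ∈ closedBall (0 : E) 1, s - A u = z}

open scoped Pointwise in
theorem unitDifferences_eq_sub (S : Set F) (A : E →L[ℝ] F) :
    unitDifferences S A = S ∩ closedBall 0 1 - A '' closedBall (0 : E) 1 := by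
  ext z
  simp [unitDifferences, Set.mem_sub]

open scoped Pointwise in
theorem isClosed_unitDifferences [FiniteDimensional ℝ E] [FiniteDimensional ℝ F] {S : Set F}
    (hS : IsClosed S) (A : E →L[ℝ] F) : IsClosed (unitDifferences S A) := by
  have : ProperSpace E := FiniteDimensional.proper ℝ E
  have : ProperSpace F := FiniteDimensional.proper ℝ F
  rw [unitDifferences_eq_sub]
  rw [sub_eq_add_neg]
  exact (((isCompact_closedBall 0 1).inter_left hS).add
    ((isCompact_closedBall 0 1).image A.continuous).neg).isClosed

theorem convex_unitDifferences {S : Set F} (hS : Convex ℝ S) (A : E →L[ℝ] F) :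
    Convex ℝ (unitDifferences S A) := by
  rw [unitDifferences_eq_sub]
  exact (hS.inter (convex_closedBall 0 1)).sub
    ((convex_closedBall (0 : E) 1).linear_image (A : E →ₗ[ℝ] F))

theorem inv_max_one_norm_smul_mem_closedBall (x : F) :
    (max 1 ‖x‖)⁻¹ • x ∈ closedBall (0 : F) 1 := by
  have hpos : 0 < max 1 ‖x‖ := lt_max_of_lt_left one_pos
  rw [mem_closedBall_zero_iff, norm_smul, norm_inv, Real.norm_of_nonneg hpos.le,
    inv_mul_le_one₀ hpos]
  exact le_max_right _ _

/-- The transversality condition makes the support function of `unitDifferences S A` positive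
away from the origin. -/
theorem exists_unitDifferences_inner_pos [CompleteSpace E] [CompleteSpace F] {S : Set F}
    (hS : Convex ℝ S) (h0 : (0 : F) ∈ S) {A : E →L[ℝ] F}
    (htrans : ∀ v : F, (∀ s ∈ S, ⟪v, s⟫ ≤ 0) → ContinuousLinearMap.adjoint A v = 0 → v = 0)
    {y : F} (hy : y ≠ 0) : ∃ z ∈ unitDifferences S A, 0 < ⟪y, z⟫ := by
  by_cases hn : ∀ s ∈ S, ⟪y, s⟫ ≤ 0
  · set x := ContinuousLinearMap.adjoint A y with hx
    have hx0 : x ≠ 0 := fun h => hy (htrans y hn h)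
    refine ⟨_, ⟨0, ⟨h0, by simp⟩, -((max 1 ‖x‖)⁻¹ • x), ?_, rfl⟩, ?_⟩
    · simpa only [mem_closedBall_zero_iff, norm_neg] using inv_max_one_norm_smul_mem_closedBall x
    · rw [map_neg, sub_neg_eq_add, zero_add, map_smul, real_inner_smul_right,
        ← ContinuousLinearMap.adjoint_inner_left, ← hx]
      exact mul_pos (inv_pos.mpr (lt_max_of_lt_left one_pos)) (real_inner_self_pos.mpr hx0)
  · push Not at hn
    obtain ⟨s, hs, hys⟩ := hn
    have hpos : 0 < max 1 ‖s‖ := lt_max_of_lt_left one_pos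
    refine ⟨_, ⟨(max 1 ‖s‖)⁻¹ • s, ⟨?_, inv_max_one_norm_smul_mem_closedBall s⟩, 0, by simp, rfl⟩,
      ?_⟩
    · exact hS.smul_mem_of_zero_mem h0 hs
        ⟨(inv_pos.mpr hpos).le, inv_le_one_of_one_le₀ (le_max_left _ _)⟩
    · rw [map_zero, sub_zero, real_inner_smul_right]
      exact mul_pos (inv_pos.mpr hpos) hys

/-- A linear lower bound on the support function of `unitDifferences S A` survives, with half the
constant, perturbations of `A`. -/
theorem exists_unitDifferences_mul_norm_le_inner {S : Set F} {A B : E →L[ℝ] F} {ε : ℝ} {y : F}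
    (h : ∃ z ∈ unitDifferences S B, ε * ‖y‖ ≤ ⟪y, z⟫) (hAB : ‖A - B‖ ≤ ε / 2) :
    ∃ z ∈ unitDifferences S A, ε / 2 * ‖y‖ ≤ ⟪y, z⟫ := by
  obtain ⟨_, ⟨s, hs, u, hu, rfl⟩, hz⟩ := h
  refine ⟨_, ⟨s, hs, u, hu, rfl⟩, ?_⟩
  have hsub : s - A u = s - B u - (A - B) u := by simp
  have hu' : ‖(A - B) u‖ ≤ ε / 2 := ((A - B).le_of_opNorm_le_of_le le_rfl
    (mem_closedBall_zero_iff.mp hu)).trans (by simpa using hAB)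
  have hle := real_inner_le_norm y ((A - B) u)
  have hmul := mul_le_mul_of_nonneg_left hu' (norm_nonneg y)
  rw [hsub, inner_sub_right]
  linarith

/-- If `unitDifferences S A` contains the closed ball of radius `r`, the inclusion `v + A u ∈ S`
is solvable for `‖v‖ ≤ r` with `u` of size at most `r⁻¹ * ‖v‖`. -/
theorem exists_add_mem_of_closedBall_subset_unitDifferences {S : Set F} (hS : Convex ℝ S)
    (h0 : (0 : F) ∈ S) {A : E →L[ℝ] F} {r : ℝ} (hr : 0 < r)
    (h : closedBall 0 r ⊆ unitDifferences S A) {v : F} (hv : ‖v‖ ≤ r) :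
    ∃ u : E, v + A u ∈ S ∧ ‖u‖ ≤ r⁻¹ * ‖v‖ := by
  rcases eq_or_ne v 0 with rfl | hv0
  · exact ⟨0, by simpa using h0, by simp⟩
  have hvpos : 0 < ‖v‖ := norm_pos_iff.mpr hv0
  set t := r⁻¹ * ‖v‖ with ht
  have htpos : 0 < t := by positivity
  have hmem : t⁻¹ • v ∈ closedBall (0 : F) r := by
    rw [mem_closedBall_zero_iff, norm_smul, norm_inv, Real.norm_of_nonneg htpos.le, ht]
    field_simp
    exact le_rfl
  obtain ⟨s, hs, u, hu, hsu⟩ := h hmem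
  refine ⟨t • u, ?_, ?_⟩
  · have heq : v + A (t • u) = t • s := by
      rw [eq_add_of_sub_eq hsu, smul_add, smul_inv_smul₀ htpos.ne', map_smul]
    rw [heq]
    exact hS.smul_mem_of_zero_mem h0 hs.1 ⟨htpos.le, by rwa [ht, inv_mul_le_one₀ hr]⟩
  · rw [norm_smul, Real.norm_of_nonneg htpos.le]
    exact mul_le_of_le_one_right htpos.le (mem_closedBall_zero_iff.mp hu)

end

/-- **Solvability of perturbed linear inclusions.** Let `S ⊆ ℝ^q` be closed convex with
`0 ∈ S` and let `Ā : ℝ^p → ℝ^q` be a linear map such that the only vector in both the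
normal cone to `S` at `0` and the kernel of `Ā*` is `0`.  Then there exist `γ, δ > 0`
such that for every `v` with `‖v‖ < δ` and every linear map `A` with `‖A - Ā‖ < δ`, the
inclusion `v + A u ∈ S` has a solution `u` with `‖u‖ ≤ γ‖v‖`. -/
theorem perturbed_inclusion_solvable (p q : ℕ)
    (S : Set (EuclideanSpace ℝ (Fin q)))
    (hSclosed : IsClosed S) (hSconv : Convex ℝ S) (h0S : (0 : EuclideanSpace ℝ (Fin q)) ∈ S)
    (Abar : EuclideanSpace ℝ (Fin p) →L[ℝ] EuclideanSpace ℝ (Fin q))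
    (htrans : ∀ v : EuclideanSpace ℝ (Fin q),
      (∀ s ∈ S, ⟪v, s⟫ ≤ 0) → ContinuousLinearMap.adjoint Abar v = 0 → v = 0) :
    ∃ γ > (0:ℝ), ∃ δ > (0:ℝ),
      ∀ v : EuclideanSpace ℝ (Fin q), ‖v‖ < δ →
      ∀ A : EuclideanSpace ℝ (Fin p) →L[ℝ] EuclideanSpace ℝ (Fin q), ‖A - Abar‖ < δ →
      ∃ u : EuclideanSpace ℝ (Fin p), v + A u ∈ S ∧ ‖u‖ ≤ γ * ‖v‖ := by
  obtain ⟨ε, hε, h⟩ := exists_forall_mul_norm_le_inner (K := unitDifferences S Abar)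
    ⟨0, ⟨h0S, by simp⟩, 0, by simp, by simp⟩
    fun y hy => exists_unitDifferences_inner_pos hSconv h0S htrans hy
  refine ⟨(ε / 2)⁻¹, inv_pos.mpr (half_pos hε), ε / 2, half_pos hε, fun v hv A hA => ?_⟩
  refine exists_add_mem_of_closedBall_subset_unitDifferences hSconv h0S (half_pos hε)
    (fun w hw => ?_) hv.le
  exact (convex_unitDifferences hSconv A).mem_of_forall_mul_norm_le_inner
    (isClosed_unitDifferences hSclosed A)
    (fun y => exists_unitDifferences_mul_norm_le_inner (h y) hA.le)
    (mem_closedBall_zero_iff.mp hw)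
end
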